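/- arXiv:1110.2001 — 3 statements merged into one kernel-verified Lean document; each statement's English description precedes it below -/
import Mathlib

section
/- Suppose T : Ω → closure(Ω) satisfies hypotheses (H0)–(H5), with λ > 1 the constant from (H3), and let L be the transfer operator of T. Then for every σ ∈ (λ^{-1}, 1) there exists B > 0 such that for every n ∈ ℕ and every h ∈ BV(Ω), ‖L^n h‖_{BV(Ω)} ≤ σ^n ‖h‖_{BV(Ω)} + B ‖h‖_{L¹(Ω,m)}. -/
open MeasureTheory Set Filter Topology
open scoped ENNReal NNReal Classical

noncomputable section

namespace Liverani

/-- The divergence of a vector field on `ℝ^d`. -/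
def divg {d : ℕ} (φ : (Fin d → ℝ) → (Fin d → ℝ)) (x : Fin d → ℝ) : ℝ :=
  ∑ j, fderiv ℝ φ x (Pi.single j 1) j

/-- Test vector fields: `C¹`, compactly supported, sup-norm `≤ 1`. -/
def IsTest (d : ℕ) (φ : (Fin d → ℝ) → (Fin d → ℝ)) : Prop :=
  ContDiff ℝ 1 φ ∧ HasCompactSupport φ ∧ ∀ x, ‖φ x‖ ≤ 1

/-- The BV seminorm on `ℝ^d`, extended-real valued. -/
def bvNormE {d : ℕ} (h : (Fin d → ℝ) → ℝ) : ℝ≥0∞ :=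
  ⨆ φ : {φ : (Fin d → ℝ) → (Fin d → ℝ) // IsTest d φ},
    ENNReal.ofReal (∫ x, h x * divg φ.1 x)

/-- The BV seminorm, real valued. -/
def bvNorm {d : ℕ} (h : (Fin d → ℝ) → ℝ) : ℝ := (bvNormE h).toReal

/-- Membership in `BV(ℝ^d)`. -/
def MemBV {d : ℕ} (h : (Fin d → ℝ) → ℝ) : Prop :=
  Integrable h volume ∧ bvNormE h < ⊤

/-- The BV seminorm on a set `Ω` (of the extension of `h` by zero), extended-real valued. -/
def bvNormOnE {d : ℕ} (Ω : Set (Fin d → ℝ)) (h : (Fin d → ℝ) → ℝ) : ℝ≥0∞ :=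
  bvNormE (Ω.indicator h)

/-- The BV norm on a set `Ω`. -/
def bvNormOn {d : ℕ} (Ω : Set (Fin d → ℝ)) (h : (Fin d → ℝ) → ℝ) : ℝ :=
  bvNorm (Ω.indicator h)

/-- Membership in `BV(Ω)`: the extension by zero belongs to `BV(ℝ^d)`. -/
def MemBVOn {d : ℕ} (Ω : Set (Fin d → ℝ)) (h : (Fin d → ℝ) → ℝ) : Prop :=
  MemBV (Ω.indicator h)

/-- One-dimensional BV seminorm (for slices). -/
def bvNorm1E (g : ℝ → ℝ) : ℝ≥0∞ :=
  ⨆ φ : {φ : ℝ → ℝ // ContDiff ℝ 1 φ ∧ HasCompactSupport φ ∧ ∀ y, |φ y| ≤ 1},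
    ENNReal.ofReal (∫ y, g y * deriv φ.1 y)

/-- The matrix norm `‖A‖_∞ = max_i Σ_j |A i j|`. -/
def matNorm {d : ℕ} (A : Matrix (Fin d) (Fin d) ℝ) : ℝ :=
  NNReal.toReal (Finset.univ.sup fun i => ∑ j, ‖A i j‖₊)

/-- The Jacobian matrix `DT` of a map `T` computed via `fderiv`. -/
def jac {d : ℕ} (T : (Fin d → ℝ) → (Fin d → ℝ)) (x : Fin d → ℝ) :
    Matrix (Fin d) (Fin d) ℝ :=
  Matrix.of fun i j => fderiv ℝ T x (Pi.single j 1) i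

/-- The inverse Jacobian matrix `(DT)⁻¹`. -/
def jacInv {d : ℕ} (T : (Fin d → ℝ) → (Fin d → ℝ)) (x : Fin d → ℝ) :
    Matrix (Fin d) (Fin d) ℝ :=
  (jac T x)⁻¹

/-- Entrywise partial derivative `∂_{x_j} (DT)⁻¹` of the inverse Jacobian along the
`j`-th coordinate. -/
def jacDj {d : ℕ} (T : (Fin d → ℝ) → (Fin d → ℝ)) (j : Fin d) (z : Fin d → ℝ) :
    Matrix (Fin d) (Fin d) ℝ :=
  Matrix.of fun i i' => deriv (fun y => jacInv T (Function.update z j y) i i') (z j)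

/-- The transfer operator `(L h)(x) = Σ_{y ∈ Ω ∩ T⁻¹{x}} |det D_y T|⁻¹ h(y)`. -/
def transferOp {d : ℕ} (Ω : Set (Fin d → ℝ)) (T : (Fin d → ℝ) → (Fin d → ℝ))
    (h : (Fin d → ℝ) → ℝ) (x : Fin d → ℝ) : ℝ :=
  ∑' y : ↥(Ω ∩ T ⁻¹' {x}), |(jac T y).det|⁻¹ * h y

/-- `Ω_k^ε`, the part of `U` at distance at least `ε` from its boundary. -/
def innerPart {d : ℕ} (U : Set (Fin d → ℝ)) (ε : ℝ) : Set (Fin d → ℝ) :=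
  {x ∈ U | ε ≤ Metric.infDist x (frontier U)}

/-- `∂^ε Ω_k`, the `ε`-boundary layer of `U`. -/
def bLayer {d : ℕ} (U : Set (Fin d → ℝ)) (ε : ℝ) : Set (Fin d → ℝ) :=
  U \ innerPart U ε

/-- `Γ_ε = ∪_k ∂^ε Ω_k`. -/
def Gam {d : ℕ} (parts : ℕ → Set (Fin d → ℝ)) (ε : ℝ) : Set (Fin d → ℝ) :=
  ⋃ k, bLayer (parts k) ε

/-- A piecewise expanding system: the data `Ω, T, {Ω_k}, {I_{k,ℓ}}, δ, λ` together with
hypotheses (H0)–(H5). -/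
structure PES (d : ℕ) where
  Ω : Set (Fin d → ℝ)
  T : (Fin d → ℝ) → (Fin d → ℝ)
  parts : ℕ → Set (Fin d → ℝ)
  Ifam : Fin d → (Fin d → ℝ) → ℕ → ℕ → Set ℝ
  δ : ℝ
  lam : ℝ
  Ω_open : IsOpen Ω
  Ω_subset : Ω ⊆ Set.Icc 0 1
  T_maps : Set.MapsTo T Ω (closure Ω)
  /-- (H0) -/
  h0 : ∀ n : ℕ, volume (T^[n] ⁻¹' frontier Ω) = 0
  /-- (H1) -/
  parts_open : ∀ k, IsOpen (parts k)
  parts_conn : ∀ k, IsPreconnected (parts k)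
  parts_disj : Pairwise (Function.onFun Disjoint parts)
  parts_union : ⋃ k, parts k = Ω
  T_C2 : ∀ k, ContDiffOn ℝ 2 T (parts k)
  T_inv : ∀ k, ∃ S : (Fin d → ℝ) → (Fin d → ℝ),
    ContDiffOn ℝ 1 S (T '' parts k) ∧ ∀ x ∈ parts k, S (T x) = x
  /-- (H2): continuous extension of `T` to the closure of each `Ω_k` -/
  h2T : ∀ k, ∃ g : (Fin d → ℝ) → (Fin d → ℝ),
    ContinuousOn g (closure (parts k)) ∧ Set.EqOn g T (parts k)
  /-- (H2): continuous extension of `(DT)⁻¹` to the closure of each `Ω_k` -/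
  h2D : ∀ k, ∃ G : (Fin d → ℝ) → Matrix (Fin d) (Fin d) ℝ,
    ContinuousOn G (closure (parts k)) ∧ Set.EqOn G (jacInv T) (parts k)
  /-- (H3): the slice structure -/
  δ_pos : 0 < δ
  lam_gt_one : 1 < lam
  Ifam_indep : ∀ (j : Fin d) (x x' : Fin d → ℝ) (k ℓ : ℕ),
    (∀ i, i ≠ j → x i = x' i) → Ifam j x k ℓ = Ifam j x' k ℓ
  Ifam_open : ∀ j x k ℓ, IsOpen (Ifam j x k ℓ)
  Ifam_conn : ∀ j x k ℓ, IsPreconnected (Ifam j x k ℓ)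
  Ifam_disj : ∀ j x k, Pairwise (Function.onFun Disjoint (Ifam j x k))
  Ifam_union : ∀ j x k, {y : ℝ | Function.update x j y ∈ parts k} = ⋃ ℓ, Ifam j x k ℓ
  h3 : ∀ x ∈ Set.Icc (0 : Fin d → ℝ) 1, ∀ j : Fin d,
    (∑' p : ℕ × ℕ,
      if (Set.Icc (x j - δ) (x j + δ) ∩ Ifam j x p.1 p.2).Nonempty then
        ⨆ y ∈ Ifam j x p.1 p.2,
          ENNReal.ofReal (matNorm (jacInv T (Function.update x j y)))
      else 0) ≤ ENNReal.ofReal lam⁻¹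
  /-- (H4) -/
  h4 : ∀ j : Fin d,
    Filter.Tendsto (fun ε : ℝ =>
      ⨆ x : Fin d → ℝ, ∑' k : ℕ, ∫⁻ y in Set.Icc (0:ℝ) 1,
        Set.indicator (bLayer (parts k) ε)
          (fun z => ENNReal.ofReal (matNorm (jacDj T j z)))
          (Function.update x j y))
      (nhdsWithin 0 (Set.Ioi 0)) (nhds 0)
  /-- (H5) -/
  h5 : ∀ i j k : Fin d,
    MeasureTheory.IntegrableOn (fun x => jac T x k j * jacInv T x j i) Ω volume

/-- A piecewise expanding system satisfying in addition hypothesis (H6). -/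
structure PES6 (d : ℕ) extends PES d where
  Cb : ℝ
  αb : ℝ
  ab : ℝ
  Cb_pos : 0 < Cb
  αb_mem : αb ∈ Set.Ioc (0:ℝ) 1
  ab_ge_one : 1 ≤ ab
  /-- (H6): measure of the boundary layers -/
  h6a : ∀ ε : ℝ, 0 < ε →
    volume (⋃ k, bLayer (parts k) ε) ≤ ENNReal.ofReal (Cb ^ d * ε ^ αb)
  /-- (H6): blow-up of `∇ det DT` near the singularities -/
  h6b : ∀ x ∈ Ω, ∀ i : Fin d,
    |fderiv ℝ (fun z => (jac T z).det) x (Pi.single i 1)| ≤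
      Cb * Metric.infDist x (frontier Ω) ^ (-ab)

/-- `μ` is a `T`-invariant probability measure, absolutely continuous w.r.t. Lebesgue,
supported in `Ω`. -/
def InvariantMeasure {d : ℕ} (Ω : Set (Fin d → ℝ)) (T : (Fin d → ℝ) → (Fin d → ℝ))
    (μ : Measure (Fin d → ℝ)) : Prop :=
  IsProbabilityMeasure μ ∧ μ ≪ volume ∧ μ Ωᶜ = 0 ∧
    ∀ A : Set (Fin d → ℝ), MeasurableSet A → μ (T ⁻¹' A) = μ A

/-- `μ` is an ergodic absolutely continuous invariant probability measure. -/
def ErgodicACIM {d : ℕ} (Ω : Set (Fin d → ℝ)) (T : (Fin d → ℝ) → (Fin d → ℝ))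
    (μ : Measure (Fin d → ℝ)) : Prop :=
  InvariantMeasure Ω T μ ∧
    ∀ A : Set (Fin d → ℝ), MeasurableSet A → T ⁻¹' A = A → μ A = 0 ∨ μ A = 1

/-- `h` is a density of `μ` with respect to Lebesgue measure. -/
def IsDensity {d : ℕ} (μ : Measure (Fin d → ℝ)) (h : (Fin d → ℝ) → ℝ) : Prop :=
  ∀ A : Set (Fin d → ℝ), MeasurableSet A → μ A = ∫⁻ x in A, ENNReal.ofReal (h x) ∂volume

/-- The system `(T, μ)` is mixing. -/
def Mixing {d : ℕ} (T : (Fin d → ℝ) → (Fin d → ℝ)) (μ : Measure (Fin d → ℝ)) : Prop :=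
  ∀ A B : Set (Fin d → ℝ), MeasurableSet A → MeasurableSet B →
    Tendsto (fun n : ℕ => μ (T^[n] ⁻¹' A ∩ B)) atTop (𝓝 (μ A * μ B))

/-- A one-dimensional mollifier. -/
def IsMollifier (η : ℝ → ℝ) : Prop :=
  ContDiff ℝ (⊤ : ℕ∞) η ∧ (∀ y, 0 ≤ η y) ∧ Function.support η ⊆ Set.Icc (-1) 1 ∧ ∫ y, η y = 1

/-- The product mollifier `η̄_δ(x) = δ^{-d} Π_i η(δ⁻¹ x_i)`. -/
def moll (d : ℕ) (η : ℝ → ℝ) (δ : ℝ) (x : Fin d → ℝ) : ℝ :=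
  (δ ^ d)⁻¹ * ∏ i, η (δ⁻¹ * x i)

/-- The regularization `h_δ(x) = ∫_Ω η̄_δ(x-y) h(y) dy + δ`. -/
def mollify (d : ℕ) (η : ℝ → ℝ) (Ω : Set (Fin d → ℝ)) (h : (Fin d → ℝ) → ℝ)
    (δ : ℝ) (x : Fin d → ℝ) : ℝ :=
  (∫ y in Ω, moll d η δ (x - y) * h y) + δ

/-- `ν₀ = ‖(DT)⁻¹‖_{L∞(Ω)}`. -/
def nu0 {d : ℕ} (Ω : Set (Fin d → ℝ)) (T : (Fin d → ℝ) → (Fin d → ℝ)) : ℝ :=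
  (essSup (fun x => ENNReal.ofReal (matNorm (jacInv T x))) (volume.restrict Ω)).toReal

/-- The truncated ("open") transfer operators
`L̃_{ε,n} = L_{ε,0} ⋯ L_{ε,n-1}` where `L_{ε,k} f = L((1 - 1_{Γ_{ε ν^k}}) f)`. -/
def tildeOp {d : ℕ} (Ω : Set (Fin d → ℝ)) (T : (Fin d → ℝ) → (Fin d → ℝ))
    (parts : ℕ → Set (Fin d → ℝ)) (ν : ℝ) :
    ℕ → ℝ → ((Fin d → ℝ) → ℝ) → (Fin d → ℝ) → ℝ
  | 0, _, f => f
  | n + 1, ε, f => transferOp Ω T (((Gam parts ε)ᶜ).indicator (tildeOp Ω T parts ν n (ε * ν) f))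

lemma abs_le_integral_right {u u' : ℝ → ℝ} (hu : ∀ y, HasDerivAt u (u' y) y)
    (hu' : Continuous u') {δ : ℝ} (hδ : 0 < δ) (b : ℝ) :
    |u b| ≤ ∫ y in b..(b + δ), (|u' y| + δ⁻¹ * |u y|) := by
  have huc : Continuous u := continuous_iff_continuousAt.2 fun y => (hu y).continuousAt
  have hF : ∀ y ∈ uIcc b (b + δ), HasDerivAt (fun y => u y * (1 - δ⁻¹ * (y - b)))
      (u' y * (1 - δ⁻¹ * (y - b)) + u y * (-δ⁻¹)) y := by
    intro y _
    have h1 : HasDerivAt (fun y : ℝ => 1 - δ⁻¹ * (y - b)) (-δ⁻¹) y := by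
      have := ((((hasDerivAt_id y).sub_const b).const_mul δ⁻¹).const_sub 1)
      simpa using this
    exact (hu y).mul h1
  have hint := intervalIntegral.integral_eq_sub_of_hasDerivAt hF
    (Continuous.intervalIntegrable (by fun_prop) _ _)
  have hz : (1 - δ⁻¹ * (b + δ - b)) = 0 := by field_simp; ring
  simp only [hz, mul_zero, sub_self, sub_zero, mul_one, zero_sub] at hint
  have : |u b| = |∫ y in b..(b + δ), (u' y * (1 - δ⁻¹ * (y - b)) + u y * (-δ⁻¹))| := by
    rw [hint, abs_neg]
  rw [this]
  refine (intervalIntegral.abs_integral_le_integral_abs (by linarith)).trans ?_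
  refine intervalIntegral.integral_mono_on (by linarith)
    (Continuous.intervalIntegrable (by fun_prop) _ _)
    (Continuous.intervalIntegrable (by fun_prop) _ _) ?_
  intro y hy
  have h0 : 0 ≤ δ⁻¹ * (y - b) := mul_nonneg (by positivity) (by linarith [hy.1])
  have h1 : δ⁻¹ * (y - b) ≤ 1 := by
    rw [inv_mul_le_iff₀ hδ]; linarith [hy.2]
  calc |u' y * (1 - δ⁻¹ * (y - b)) + u y * (-δ⁻¹)|
      ≤ |u' y| * |1 - δ⁻¹ * (y - b)| + |u y| * |(-δ⁻¹)| := by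
        rw [← abs_mul, ← abs_mul]; exact abs_add_le _ _
    _ ≤ |u' y| * 1 + |u y| * δ⁻¹ := by
        rw [abs_neg, abs_of_pos (inv_pos.2 hδ)]
        gcongr
        rw [abs_le]; constructor <;> linarith
    _ = _ := by ring

lemma abs_le_integral_left {u u' : ℝ → ℝ} (hu : ∀ y, HasDerivAt u (u' y) y)
    (hu' : Continuous u') {δ : ℝ} (hδ : 0 < δ) (a : ℝ) :
    |u a| ≤ ∫ y in (a - δ)..a, (|u' y| + δ⁻¹ * |u y|) := by
  have h := abs_le_integral_right (u := fun y => u (-y)) (u' := fun y => -u' (-y))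
    (fun y => by
      simpa [Function.comp_def] using (hu (-y)).comp y (hasDerivAt_neg y)) (by fun_prop) hδ (-a)
  simp only [neg_neg, abs_neg] at h
  have := intervalIntegral.integral_comp_neg (a := -a) (b := -a + δ)
    (fun y => |u' y| + δ⁻¹ * |u y|)
  rw [this] at h
  convert h using 2 <;> ring

lemma abs_integral_mul_deriv_le {u u' ψ ψ' : ℝ → ℝ} (hu : ∀ y, HasDerivAt u (u' y) y)
    (hu' : Continuous u') {δ : ℝ} (hδ : 0 < δ) {a b M : ℝ} (hab : a ≤ b)
    (hψ : ∀ y ∈ Icc a b, HasDerivAt ψ (ψ' y) y) (hψ' : ContinuousOn ψ' (Icc a b))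
    (hM : ∀ y ∈ Icc a b, |ψ y| ≤ M) :
    |∫ y in a..b, u y * ψ' y| ≤
      M * ∫ y in (a - δ)..(b + δ), (|u' y| + δ⁻¹ * |u y|) := by
  have huc : Continuous u := continuous_iff_continuousAt.2 fun y => (hu y).continuousAt
  have hM0 : 0 ≤ M := (abs_nonneg _).trans (hM a ⟨le_rfl, hab⟩)
  have hparts := intervalIntegral.integral_mul_deriv_eq_deriv_mul (a := a) (b := b)
    (u := u) (v := ψ) (u' := u') (v' := ψ') (fun y _ => hu y)
    (fun y hy => hψ y (by rwa [uIcc_of_le hab] at hy))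
    (hu'.intervalIntegrable _ _)
    (ContinuousOn.intervalIntegrable (by rwa [uIcc_of_le hab]))
  have hψc : ContinuousOn ψ (Icc a b) := fun y hy => (hψ y hy).continuousAt.continuousWithinAt
  set g : ℝ → ℝ := fun y => |u' y| + δ⁻¹ * |u y| with hg
  have hgc : Continuous g := by fun_prop
  have hgi : ∀ s t, IntervalIntegrable g volume s t := fun s t => hgc.intervalIntegrable _ _
  have hmid : |∫ y in a..b, u' y * ψ y| ≤ M * ∫ y in a..b, g y := by
    refine (intervalIntegral.abs_integral_le_integral_abs hab).trans ?_
    rw [← intervalIntegral.integral_const_mul]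
    refine intervalIntegral.integral_mono_on hab
      (ContinuousOn.intervalIntegrable (by rw [uIcc_of_le hab]; fun_prop))
      (Continuous.intervalIntegrable (by fun_prop) _ _) ?_
    intro y hy
    rw [abs_mul, mul_comm]
    refine mul_le_mul (hM y hy) ?_ (abs_nonneg _) hM0
    have : 0 ≤ δ⁻¹ * |u y| := by positivity
    simp only [hg]; linarith
  have hr := abs_le_integral_right hu hu' hδ b
  have hl := abs_le_integral_left hu hu' hδ a
  have hsum : ∫ y in (a - δ)..(b + δ), g y =
      (∫ y in (a - δ)..a, g y) + (∫ y in a..b, g y) + ∫ y in b..(b + δ), g y := by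
    rw [intervalIntegral.integral_add_adjacent_intervals (hgi _ _) (hgi _ _),
      intervalIntegral.integral_add_adjacent_intervals (hgi _ _) (hgi _ _)]
  rw [hparts, hsum]
  have hub : |u b * ψ b| ≤ M * ∫ y in b..(b + δ), g y := by
    rw [abs_mul, mul_comm]
    exact mul_le_mul (hM b ⟨hab, le_rfl⟩) hr (abs_nonneg _) hM0
  have hua : |u a * ψ a| ≤ M * ∫ y in (a - δ)..a, g y := by
    rw [abs_mul, mul_comm]
    exact mul_le_mul (hM a ⟨le_rfl, hab⟩) hl (abs_nonneg _) hM0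
  calc |u b * ψ b - u a * ψ a - ∫ y in a..b, u' y * ψ y|
      ≤ |u b * ψ b| + |u a * ψ a| + |∫ y in a..b, u' y * ψ y| :=
        (abs_sub _ _).trans (add_le_add_left (abs_sub _ _) _)
    _ ≤ _ := by linarith

lemma enorm_le_lintegral_deriv {u u' : ℝ → ℝ} (hu : ∀ y, HasDerivAt u (u' y) y)
    (hu' : Continuous u') (hc : HasCompactSupport u) (y : ℝ) :
    ‖u y‖ₑ ≤ ∫⁻ t, ‖u' t‖ₑ := by
  have hd : deriv u = u' := funext fun t => (hu t).deriv
  have hcd : HasCompactSupport u' := hd ▸ hc.deriv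
  have hc1 : ContDiff ℝ 1 u := contDiff_one_iff_deriv.2
    ⟨fun t => (hu t).differentiableAt, hd ▸ hu'⟩
  have := HasCompactSupport.enorm_le_lintegral_Ici_deriv (F := ℝ) hc1 hc y
  rw [hd] at this
  exact this.trans (setLIntegral_le_lintegral _ _)

lemma exists_eq_Ioo_of_preconnected {I : Set ℝ} (ho : IsOpen I) (hp : IsPreconnected I)
    (hne : I.Nonempty) (hb : I ⊆ Icc 0 1) : ∃ a b, a < b ∧ I = Ioo a b := by
  have hbb : BddBelow I := bddBelow_Icc.mono hb
  have hba : BddAbove I := bddAbove_Icc.mono hb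
  have hI : I = Ioo (sInf I) (sSup I) := by
    refine Subset.antisymm ?_ (IsConnected.Ioo_csInf_csSup_subset ⟨hne, hp⟩ hbb hba)
    intro y hy
    obtain ⟨ε, hε, hball⟩ := Metric.isOpen_iff.1 ho y hy
    refine ⟨lt_of_le_of_lt (csInf_le hbb (hball (?_ : y - ε / 2 ∈ _))) (by linarith),
      lt_of_lt_of_le (?_ : y < y + ε / 2) (le_csSup hba (hball (?_ : y + ε / 2 ∈ _)))⟩
    · simp [abs_of_pos hε, hε]
    · linarith
    · simp [abs_of_pos hε, hε]
  obtain ⟨y, hy⟩ := hne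
  rw [hI] at hy
  exact ⟨_, _, hy.1.trans hy.2, hI⟩

lemma setIntegral_Ioo_le_of_Icc {a b : ℝ} {f : ℝ → ℝ} {C : ℝ≥0∞}
    (hab : a < b) (hf : IntegrableOn f (Ioo a b))
    (h : ∀ s t, a < s → s ≤ t → t < b → ENNReal.ofReal (∫ y in s..t, f y) ≤ C) :
    ENNReal.ofReal (∫ y in Ioo a b, f y) ≤ C := by
  set c : ℕ → ℝ := fun n => (b - a) / 2 / (n + 1)
  have hc0 : ∀ n, 0 < c n := fun n => by
    have : 0 < b - a := sub_pos.2 hab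
    positivity
  have hc1 : ∀ n, c n ≤ (b - a) / 2 := fun n => by
    refine div_le_self (by linarith) ?_
    have : (0 : ℝ) ≤ n := Nat.cast_nonneg n
    linarith
  have hcl : Tendsto c atTop (𝓝 0) :=
    tendsto_const_div_atTop_nhds_zero_nat ((b - a) / 2) |>.comp (tendsto_add_atTop_nat 1)
      |>.congr fun n => by simp [c]
  have hcov : AECover (volume.restrict (Ioo a b)) atTop
      (fun n : ℕ => Icc (a + c n) (b - c n)) :=
    aecover_Ioo_of_Icc (by simpa using hcl.const_add a) (by simpa using hcl.const_sub b)
  have hlim := hcov.integral_tendsto_of_countably_generated hf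
  refine le_of_tendsto ((ENNReal.continuous_ofReal.tendsto _).comp hlim)
    (Eventually.of_forall fun n => ?_)
  have hle : a + c n ≤ b - c n := by linarith [hc1 n]
  have hsub : Icc (a + c n) (b - c n) ⊆ Ioo a b := fun y hy =>
    ⟨by linarith [hy.1, hc0 n], by linarith [hy.2, hc0 n]⟩
  have := h (a + c n) (b - c n) (by linarith [hc0 n]) hle (by linarith [hc0 n])
  rw [intervalIntegral.integral_of_le hle, ← integral_Icc_eq_integral_Ioc] at this
  simpa [Measure.restrict_restrict measurableSet_Icc, inter_eq_self_of_subset_left hsub] using this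

lemma ofReal_integral_Ioo_le {u u' ψ F E : ℝ → ℝ} (hu : ∀ y, HasDerivAt u (u' y) y)
    (hu' : Continuous u') {δ : ℝ} (hδ : 0 < δ) {I : Set ℝ} (ho : IsOpen I)
    (hp : IsPreconnected I) (hb : I ⊆ Icc 0 1)
    (hψ : ∀ y ∈ I, HasDerivAt ψ (F y + E y) y) (hF : ContinuousOn F I)
    (hE : ContinuousOn E I) {M : ℝ≥0∞} (hMt : I.Nonempty → M ≠ ⊤) (hM : ∀ y ∈ I, ‖ψ y‖ₑ ≤ M)
    (hint : IntegrableOn (fun y => u y * F y) I) :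
    ENNReal.ofReal (∫ y in I, u y * F y) ≤
      M * (∫⁻ y in {y | (Icc (y - δ) (y + δ) ∩ I).Nonempty},
        (‖u' y‖ₑ + ENNReal.ofReal δ⁻¹ * ‖u y‖ₑ)) + ∫⁻ y in I, ‖u y‖ₑ * ‖E y‖ₑ := by
  have huc : Continuous u := continuous_iff_continuousAt.2 fun y => (hu y).continuousAt
  rcases I.eq_empty_or_nonempty with rfl | hne
  · simp
  obtain ⟨a, b, hab, rfl⟩ := exists_eq_Ioo_of_preconnected ho hp hne hb
  replace hMt := hMt hne
  refine setIntegral_Ioo_le_of_Icc hab hint fun s t hs hst ht => ?_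
  have hsub : Icc s t ⊆ Ioo a b := Icc_subset_Ioo hs ht
  have hF' := hF.mono hsub
  have hE' := hE.mono hsub
  have hiF : IntervalIntegrable (fun y => u y * (F y + E y)) volume s t :=
    ContinuousOn.intervalIntegrable (by rw [uIcc_of_le hst]; fun_prop)
  have hiE : IntervalIntegrable (fun y => u y * E y) volume s t :=
    ContinuousOn.intervalIntegrable (by rw [uIcc_of_le hst]; fun_prop)
  have hsplit : ∫ y in s..t, u y * F y =
      (∫ y in s..t, u y * (F y + E y)) - ∫ y in s..t, u y * E y := by
    rw [← intervalIntegral.integral_sub hiF hiE]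
    refine intervalIntegral.integral_congr fun y _ => ?_
    ring
  have hMr : ∀ y ∈ Icc s t, |ψ y| ≤ M.toReal := fun y hy => by
    have := ENNReal.toReal_mono hMt (hM y (hsub hy))
    simpa using this
  have h1 := abs_integral_mul_deriv_le hu hu' hδ hst (fun y hy => hψ y (hsub hy))
    (hF'.add hE') hMr
  have h2 : ENNReal.ofReal |∫ y in s..t, u y * E y| ≤
      ∫⁻ y in Ioo a b, ‖u y‖ₑ * ‖E y‖ₑ := by
    rw [← Real.enorm_eq_ofReal_abs, intervalIntegral.integral_of_le hst]
    refine (enorm_integral_le_lintegral_enorm _).trans ?_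
    simp only [enorm_mul]
    exact lintegral_mono_set (Ioc_subset_Icc_self.trans hsub)
  have h3 : ENNReal.ofReal (∫ y in (s - δ)..(t + δ), (|u' y| + δ⁻¹ * |u y|)) ≤
      ∫⁻ y in {y | (Icc (y - δ) (y + δ) ∩ Ioo a b).Nonempty},
        (‖u' y‖ₑ + ENNReal.ofReal δ⁻¹ * ‖u y‖ₑ) := by
    have hle : s - δ ≤ t + δ := by linarith
    rw [intervalIntegral.integral_of_le hle, ofReal_integral_eq_lintegral_ofReal]
    · refine (lintegral_mono_set (?_ : Ioc (s - δ) (t + δ) ⊆ _)).trans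
        (lintegral_mono fun y => ?_)
      · intro y hy
        rcases lt_or_ge y s with h | h
        · exact ⟨s, ⟨by linarith, by linarith [hy.1]⟩, hsub ⟨le_rfl, hst⟩⟩
        rcases lt_or_ge t y with h' | h'
        · exact ⟨t, ⟨by linarith [hy.2], by linarith⟩, hsub ⟨hst, le_rfl⟩⟩
        · exact ⟨y, ⟨by linarith, by linarith⟩, hsub ⟨h, h'⟩⟩
      · refine le_of_eq ?_
        have h0 : (0:ℝ) ≤ δ⁻¹ := by positivity
        rw [ENNReal.ofReal_add (abs_nonneg _) (by positivity), ENNReal.ofReal_mul h0,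
          ← Real.enorm_eq_ofReal_abs, ← Real.enorm_eq_ofReal_abs]
    · exact (Continuous.integrableOn_Icc (by fun_prop)).mono_set Ioc_subset_Icc_self
    · exact Eventually.of_forall fun y => by
        have : (0:ℝ) ≤ δ⁻¹ := by positivity
        positivity
  calc ENNReal.ofReal (∫ y in s..t, u y * F y)
      ≤ ENNReal.ofReal (|∫ y in s..t, u y * (F y + E y)| + |∫ y in s..t, u y * E y|) := by
        rw [hsplit]
        exact ENNReal.ofReal_le_ofReal ((le_abs_self _).trans (abs_sub _ _))
    _ ≤ ENNReal.ofReal (M.toReal * ∫ y in (s - δ)..(t + δ), (|u' y| + δ⁻¹ * |u y|)) +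
        ENNReal.ofReal |∫ y in s..t, u y * E y| := by
        rw [ENNReal.ofReal_add (abs_nonneg _) (abs_nonneg _)]
        gcongr
    _ ≤ _ := by
        rw [ENNReal.ofReal_mul ENNReal.toReal_nonneg, ENNReal.ofReal_toReal hMt]
        gcongr

lemma ofReal_sum_le {ι : Type*} (t : Finset ι) (f : ι → ℝ) :
    ENNReal.ofReal (∑ i ∈ t, f i) ≤ ∑ i ∈ t, ENNReal.ofReal (f i) :=
  Finset.le_sum_of_subadditive _ ENNReal.ofReal_zero.le (fun _ _ => ENNReal.ofReal_add_le) t f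

lemma ofReal_tsum_le_of_hasSum {ι : Type*} {f : ι → ℝ} {s : ℝ} (h : HasSum f s) :
    ENNReal.ofReal s ≤ ∑' i, ENNReal.ofReal (f i) :=
  le_of_tendsto ((ENNReal.continuous_ofReal.tendsto _).comp h)
    (Eventually.of_forall fun t => (ofReal_sum_le t f).trans (ENNReal.sum_le_tsum t))

open scoped Pointwise in
/-- One-dimensional estimate against a piecewise `C¹` function `ψ` with derivative `F + E` on
countably many intervals; the intervals only need to overlap boundedly at scale `δ`. -/
lemma ofReal_integral_iUnion_le {ι : Type*} [Countable ι] {u u' ψ F E : ℝ → ℝ}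
    (hu : ∀ y, HasDerivAt u (u' y) y)
    (hu' : Continuous u') {δ : ℝ} (hδ : 0 < δ) {I : ι → Set ℝ} (ho : ∀ p, IsOpen (I p))
    (hp : ∀ p, IsPreconnected (I p)) (hb : ∀ p, I p ⊆ Icc 0 1)
    (hd : Pairwise (Function.onFun Disjoint I))
    (hψ : ∀ p, ∀ y ∈ I p, HasDerivAt ψ (F y + E y) y) (hF : ∀ p, ContinuousOn F (I p))
    (hE : ∀ p, ContinuousOn E (I p)) {M : ι → ℝ≥0∞} (hM : ∀ p, ∀ y ∈ I p, ‖ψ y‖ₑ ≤ M p)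
    {Λ : ℝ≥0∞} (hΛ : Λ ≠ ⊤)
    (hsum : ∀ y, (∑' p, if (Icc (y - δ) (y + δ) ∩ I p).Nonempty then M p else 0) ≤ Λ)
    (hint : IntegrableOn (fun y => u y * F y) (⋃ p, I p)) :
    ENNReal.ofReal (∫ y in ⋃ p, I p, u y * F y) ≤
      Λ * (∫⁻ y, (‖u' y‖ₑ + ENNReal.ofReal δ⁻¹ * ‖u y‖ₑ)) +
        ∫⁻ y in ⋃ p, I p, ‖u y‖ₑ * ‖E y‖ₑ := by
  have huc : Continuous u := continuous_iff_continuousAt.2 fun y => (hu y).continuousAt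
  have hms : ∀ p, MeasurableSet (I p) := fun p => (ho p).measurableSet
  have hMt : ∀ p, (I p).Nonempty → M p ≠ ⊤ := by
    rintro p ⟨y, hy⟩ htop
    have h1 := (ENNReal.le_tsum p).trans (hsum y)
    rw [if_pos ⟨y, ⟨by linarith, by linarith⟩, hy⟩, htop] at h1
    exact hΛ (top_le_iff.1 h1)
  set g : ℝ → ℝ≥0∞ := fun y => ‖u' y‖ₑ + ENNReal.ofReal δ⁻¹ * ‖u y‖ₑ with hg
  have hgm : Measurable g := by
    have := hu'.measurable
    have := huc.measurable
    fun_prop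
  have hJm : ∀ p, MeasurableSet {y | (Icc (y - δ) (y + δ) ∩ I p).Nonempty} := by
    intro p
    have : {y | (Icc (y - δ) (y + δ) ∩ I p).Nonempty} = I p + Icc (-δ) δ := by
      ext y
      simp only [Set.mem_ofPred_eq, Set.mem_add]
      constructor
      · rintro ⟨z, hz, hzI⟩
        exact ⟨z, hzI, y - z, ⟨by linarith [hz.2], by linarith [hz.1]⟩, by ring⟩
      · rintro ⟨z, hzI, w, hw, rfl⟩
        exact ⟨z, ⟨by linarith [hw.2], by linarith [hw.1]⟩, hzI⟩
    rw [this]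
    exact (ho p).add_right.measurableSet
  refine (ofReal_tsum_le_of_hasSum (hasSum_integral_iUnion hms hd hint)).trans ?_
  refine (ENNReal.tsum_le_tsum fun p => ofReal_integral_Ioo_le hu hu' hδ (ho p) (hp p) (hb p)
    (hψ p) (hF p) (hE p) (hMt p) (hM p) (hint.mono_set (subset_iUnion _ p))).trans ?_
  rw [ENNReal.tsum_add, lintegral_iUnion hms hd]
  gcongr
  have h1 : ∀ p, M p * ∫⁻ y in {y | (Icc (y - δ) (y + δ) ∩ I p).Nonempty}, g y =
      ∫⁻ y, (if (Icc (y - δ) (y + δ) ∩ I p).Nonempty then M p else 0) * g y := by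
    intro p
    rw [← lintegral_const_mul _ hgm, ← lintegral_indicator (hJm p)]
    refine lintegral_congr fun y => ?_
    by_cases h : (Icc (y - δ) (y + δ) ∩ I p).Nonempty
    · rw [indicator_of_mem (by exact h), if_pos h]
    · rw [indicator_of_notMem (by exact h), if_neg h, zero_mul]
  rw [tsum_congr h1, ← lintegral_tsum, ← lintegral_const_mul _ hgm]
  · refine lintegral_mono fun y => ?_
    simp only [ENNReal.tsum_mul_right]
    gcongr
    exact hsum y
  · intro p
    exact ((measurable_const.ite (hJm p) measurable_const).mul hgm).aemeasurable

namespace PES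

variable {d : ℕ} (S : PES d)

lemma contDiffAt_T {k : ℕ} {x : Fin d → ℝ} (hx : x ∈ S.parts k) : ContDiffAt ℝ 2 S.T x :=
  (S.T_C2 k).contDiffAt ((S.parts_open k).mem_nhds hx)

lemma hasFDerivAt_T {k : ℕ} {x : Fin d → ℝ} (hx : x ∈ S.parts k) :
    HasFDerivAt S.T (fderiv ℝ S.T x) x :=
  ((S.contDiffAt_T hx).differentiableAt (by norm_num)).hasFDerivAt

lemma jac_eq_toMatrix' (T : (Fin d → ℝ) → (Fin d → ℝ)) (x : Fin d → ℝ) :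
    jac T x = LinearMap.toMatrix' (fderiv ℝ T x : (Fin d → ℝ) →ₗ[ℝ] (Fin d → ℝ)) := by
  ext i j
  simp [jac, LinearMap.toMatrix'_apply, Pi.single]

lemma det_jac (T : (Fin d → ℝ) → (Fin d → ℝ)) (x : Fin d → ℝ) :
    (jac T x).det = (fderiv ℝ T x).det := by
  rw [jac_eq_toMatrix', LinearMap.det_toMatrix']

lemma det_jac_ne_zero {k : ℕ} {x : Fin d → ℝ} (hx : x ∈ S.parts k) :
    (jac S.T x).det ≠ 0 := by
  obtain ⟨R, hR, hRT⟩ := S.T_inv k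
  have h1 : HasFDerivWithinAt R (fderivWithin ℝ R (S.T '' S.parts k) (S.T x))
      (S.T '' S.parts k) (S.T x) :=
    ((hR _ (mem_image_of_mem _ hx)).differentiableWithinAt (by norm_num)).hasFDerivWithinAt
  have h2 := h1.comp x (S.hasFDerivAt_T hx).hasFDerivWithinAt (mapsTo_image _ _)
  have h4 : HasFDerivAt (R ∘ S.T)
      ((fderivWithin ℝ R (S.T '' S.parts k) (S.T x)).comp (fderiv ℝ S.T x)) x :=
    h2.hasFDerivAt ((S.parts_open k).mem_nhds hx)
  have h5 : HasFDerivAt (R ∘ S.T) (ContinuousLinearMap.id ℝ (Fin d → ℝ)) x :=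
    (hasFDerivAt_id x).congr_of_eventuallyEq
      (eventually_of_mem ((S.parts_open k).mem_nhds hx) fun y hy => hRT y hy)
  have h6 := h4.unique h5
  have h7 : LinearMap.det (fderivWithin ℝ R (S.T '' S.parts k) (S.T x) :
      (Fin d → ℝ) →ₗ[ℝ] (Fin d → ℝ)) * LinearMap.det (fderiv ℝ S.T x :
      (Fin d → ℝ) →ₗ[ℝ] (Fin d → ℝ)) = 1 := by
    rw [← LinearMap.det_comp]
    exact (congrArg ContinuousLinearMap.det h6).trans LinearMap.det_id
  rw [det_jac]
  exact right_ne_zero_of_mul_eq_one h7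

lemma contDiffAt_jac {k : ℕ} {x : Fin d → ℝ} (hx : x ∈ S.parts k) (i j : Fin d) :
    ContDiffAt ℝ 1 (fun x => jac S.T x i j) x := by
  have h1 : ContDiffAt ℝ 1 (fderiv ℝ S.T) x := (S.contDiffAt_T hx).fderiv_right (by norm_num)
  have h2 : ContDiffAt ℝ 1 (fun x => fderiv ℝ S.T x (Pi.single j 1)) x :=
    h1.clm_apply contDiffAt_const
  exact contDiffAt_pi.1 h2 i

lemma _root_.Liverani.contDiffAt_det {n : ℕ} {X : Type*} [NormedAddCommGroup X] [NormedSpace ℝ X]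
    {A : X → Matrix (Fin n) (Fin n) ℝ} {x : X} (h : ∀ i j, ContDiffAt ℝ 1 (fun x => A x i j) x) :
    ContDiffAt ℝ 1 (fun x => (A x).det) x := by
  simp only [Matrix.det_apply']
  exact ContDiffAt.sum fun σ _ => contDiffAt_const.mul (contDiffAt_prod fun i _ => h _ _)

lemma contDiffAt_jacInv {k : ℕ} {x : Fin d → ℝ} (hx : x ∈ S.parts k) (i j : Fin d) :
    ContDiffAt ℝ 1 (fun x => jacInv S.T x i j) x := by
  have : (fun x => jacInv S.T x i j) =
      fun x => ((jac S.T x).det)⁻¹ * ((jac S.T x).updateRow j (Pi.single i 1)).det := by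
    ext x
    simp [jacInv, Matrix.inv_def, Matrix.adjugate_apply]
  rw [this]
  refine (ContDiffAt.inv (contDiffAt_det (S.contDiffAt_jac hx)) (S.det_jac_ne_zero hx)).mul
    (contDiffAt_det fun a b => ?_)
  by_cases h : a = j
  · subst h
    simpa using contDiffAt_const
  · simpa [Matrix.updateRow_ne h] using S.contDiffAt_jac hx a b

lemma jac_mul_jacInv {k : ℕ} {x : Fin d → ℝ} (hx : x ∈ S.parts k) :
    jac S.T x * jacInv S.T x = 1 :=
  Matrix.mul_nonsing_inv _ (isUnit_iff_ne_zero.2 (S.det_jac_ne_zero hx))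

lemma jacDj_eq {k : ℕ} {x : Fin d → ℝ} (hx : x ∈ S.parts k) (j a b : Fin d) :
    jacDj S.T j x a b = fderiv ℝ (fun x => jacInv S.T x a b) x (Pi.single j 1) := by
  have h := ((S.contDiffAt_jacInv hx a b).differentiableAt (by norm_num)).hasFDerivAt
  have hx' : x = Function.update x j (x j) := by simp
  have h' : HasFDerivAt (fun x => jacInv S.T x a b) (fderiv ℝ (fun x => jacInv S.T x a b) x)
      (Function.update x j (x j)) := by rwa [← hx']
  exact (h'.comp_hasDerivAt (x j) (hasDerivAt_update x j (x j))).deriv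

lemma continuousAt_jacDj {k : ℕ} {x : Fin d → ℝ} (hx : x ∈ S.parts k) (j a b : Fin d) :
    ContinuousAt (fun x => jacDj S.T j x a b) x := by
  have h1 : ContDiffAt ℝ 0 (fderiv ℝ (fun x => jacInv S.T x a b)) x :=
    (S.contDiffAt_jacInv hx a b).fderiv_right (by norm_num)
  have h2 : ContinuousAt (fun x => fderiv ℝ (fun x => jacInv S.T x a b) x (Pi.single j 1)) x :=
    h1.continuousAt.clm_apply continuousAt_const
  exact h2.congr (eventually_of_mem ((S.parts_open k).mem_nhds hx)
    fun y hy => (S.jacDj_eq hy j a b).symm)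

/-- The `j`-th component of the pulled back vector field `(DT)⁻¹ (φ ∘ T)`. -/
def pullback (φ : (Fin d → ℝ) → (Fin d → ℝ)) (j : Fin d) (x : Fin d → ℝ) : ℝ :=
  ∑ i, jacInv S.T x j i * φ (S.T x) i

/-- The contribution of the `j`-th coordinate to `(div φ) ∘ T`. -/
def divTerm (φ : (Fin d → ℝ) → (Fin d → ℝ)) (j : Fin d) (x : Fin d → ℝ) : ℝ :=
  ∑ i, ∑ k, fderiv ℝ φ (S.T x) (Pi.single k 1) i * (jac S.T x k j * jacInv S.T x j i)

/-- The distortion term `Σ_i ∂_j [(DT)⁻¹]_{ji} φ_i ∘ T`. -/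
def distTerm (φ : (Fin d → ℝ) → (Fin d → ℝ)) (j : Fin d) (x : Fin d → ℝ) : ℝ :=
  ∑ i, jacDj S.T j x j i * φ (S.T x) i

lemma sum_divTerm (φ : (Fin d → ℝ) → (Fin d → ℝ)) {k : ℕ} {x : Fin d → ℝ}
    (hx : x ∈ S.parts k) : ∑ j, S.divTerm φ j x = divg φ (S.T x) := by
  unfold divTerm divg
  rw [Finset.sum_comm]
  refine Finset.sum_congr rfl fun i _ => ?_
  rw [Finset.sum_comm]
  have h : ∀ l, ∑ j, jac S.T x l j * jacInv S.T x j i = (1 : Matrix (Fin d) (Fin d) ℝ) l i := by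
    intro l
    rw [← S.jac_mul_jacInv hx, Matrix.mul_apply]
  simp only [← Finset.mul_sum, h, Matrix.one_apply]
  simp

lemma hasDerivAt_pullback {φ : (Fin d → ℝ) → (Fin d → ℝ)} (hφ : ContDiff ℝ 1 φ) (j : Fin d)
    {k : ℕ} {x : Fin d → ℝ} {y : ℝ} (hx : Function.update x j y ∈ S.parts k) :
    HasDerivAt (fun y => S.pullback φ j (Function.update x j y))
      (S.divTerm φ j (Function.update x j y) + S.distTerm φ j (Function.update x j y)) y := by
  set z := Function.update x j y with hz
  have hup : HasDerivAt (fun y => Function.update x j y) (Pi.single j 1) y :=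
    hasDerivAt_update x j y
  have hT : HasDerivAt (fun y => S.T (Function.update x j y)) (fderiv ℝ S.T z (Pi.single j 1)) y :=
    (S.hasFDerivAt_T hx).comp_hasDerivAt y hup
  have hφT : HasDerivAt (fun y => φ (S.T (Function.update x j y)))
      (fderiv ℝ φ (S.T z) (fderiv ℝ S.T z (Pi.single j 1))) y :=
    ((hφ.differentiable (by norm_num) (S.T z)).hasFDerivAt).comp_hasDerivAt y hT
  have hexp : fderiv ℝ S.T z (Pi.single j 1) =
      ∑ l, jac S.T z l j • (Pi.single l 1 : Fin d → ℝ) := by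
    exact (pi_eq_sum_univ' (fderiv ℝ S.T z (Pi.single j 1))).trans rfl
  have hA : ∀ i, HasDerivAt (fun y => jacInv S.T (Function.update x j y) j i)
      (jacDj S.T j z j i) y := fun i => by
    rw [S.jacDj_eq hx]
    exact (((S.contDiffAt_jacInv hx j i).differentiableAt
      (by norm_num)).hasFDerivAt).comp_hasDerivAt y hup
  have := HasDerivAt.fun_sum (u := Finset.univ) fun i _ => (hA i).mul (hasDerivAt_pi.1 hφT i)
  refine this.congr_deriv ?_
  rw [Finset.sum_add_distrib, add_comm]
  unfold divTerm distTerm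
  congr 1
  refine Finset.sum_congr rfl fun i _ => ?_
  rw [hexp, map_sum, Finset.sum_apply, Finset.mul_sum]
  refine Finset.sum_congr rfl fun l _ => ?_
  simp only [map_smul, Pi.smul_apply, smul_eq_mul]
  ring

lemma continuousOn_distTerm {φ : (Fin d → ℝ) → (Fin d → ℝ)} (hφ : ContDiff ℝ 1 φ) (j : Fin d)
    (k : ℕ) : ContinuousOn (S.distTerm φ j) (S.parts k) := by
  intro x hx
  refine ContinuousAt.continuousWithinAt ?_
  unfold distTerm
  refine tendsto_finsetSum _ fun i _ => (S.continuousAt_jacDj hx j j i).mul ?_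
  have h1 : ContinuousAt (fun x => φ (S.T x)) x :=
    hφ.continuous.continuousAt.comp (S.contDiffAt_T hx).continuousAt
  exact (continuous_apply i).continuousAt.comp h1

lemma continuousOn_divTerm {φ : (Fin d → ℝ) → (Fin d → ℝ)} (hφ : ContDiff ℝ 1 φ) (j : Fin d)
    (k : ℕ) : ContinuousOn (S.divTerm φ j) (S.parts k) := by
  intro x hx
  refine ContinuousAt.continuousWithinAt ?_
  unfold divTerm
  refine tendsto_finsetSum _ fun i _ => tendsto_finsetSum _ fun l _ => ContinuousAt.mul ?_
    ((S.contDiffAt_jac hx l j).continuousAt.mul (S.contDiffAt_jacInv hx j i).continuousAt)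
  have h0 : Continuous fun x => fderiv ℝ φ x (Pi.single l 1) i :=
    (continuous_apply i).comp ((hφ.continuous_fderiv (by norm_num)).clm_apply continuous_const)
  exact h0.continuousAt.comp (S.contDiffAt_T hx).continuousAt

lemma _root_.Liverani.abs_sum_mul_le_matNorm {n : ℕ} (A : Matrix (Fin n) (Fin n) ℝ)
    {v : Fin n → ℝ} (hv : ‖v‖ ≤ 1) (j : Fin n) : |∑ i, A j i * v i| ≤ matNorm A := by
  have h1 : |∑ i, A j i * v i| ≤ ∑ i, |A j i| := by
    refine (Finset.abs_sum_le_sum_abs _ _).trans (Finset.sum_le_sum fun i _ => ?_)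
    rw [abs_mul]
    exact mul_le_of_le_one_right (abs_nonneg _) ((norm_le_pi_norm v i).trans hv)
  refine h1.trans ?_
  have h2 := Finset.le_sup (f := fun i => ∑ j, ‖A i j‖₊) (Finset.mem_univ j)
  have h3 := NNReal.coe_le_coe.2 h2
  simpa [matNorm] using h3

lemma enorm_pullback_le {φ : (Fin d → ℝ) → (Fin d → ℝ)} (hφ : ∀ x, ‖φ x‖ ≤ 1) (j : Fin d)
    (x : Fin d → ℝ) : ‖S.pullback φ j x‖ₑ ≤ ENNReal.ofReal (matNorm (jacInv S.T x)) := by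
  rw [Real.enorm_eq_ofReal_abs]
  exact ENNReal.ofReal_le_ofReal (abs_sum_mul_le_matNorm _ (hφ _) j)

lemma enorm_distTerm_le {φ : (Fin d → ℝ) → (Fin d → ℝ)} (hφ : ∀ x, ‖φ x‖ ≤ 1) (j : Fin d)
    (x : Fin d → ℝ) : ‖S.distTerm φ j x‖ₑ ≤ ENNReal.ofReal (matNorm (jacDj S.T j x)) := by
  rw [Real.enorm_eq_ofReal_abs]
  exact ENNReal.ofReal_le_ofReal (abs_sum_mul_le_matNorm _ (hφ _) j)

end PES

lemma ball_subset_of_mem_innerPart {d : ℕ} {U : Set (Fin d → ℝ)} {ε : ℝ} {x : Fin d → ℝ}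
    (hx : x ∈ innerPart U ε) : Metric.ball x ε ⊆ U := by
  intro y hy
  by_contra hyU
  obtain ⟨z, hz, hzd⟩ := exists_mem_frontier_infDist_compl_eq_dist hx.1
    (fun h => hyU (h ▸ mem_univ y))
  have h1 : Metric.infDist x Uᶜ ≤ dist x y := Metric.infDist_le_dist_of_mem hyU
  have h2 := Metric.infDist_le_dist_of_mem (x := x) hz
  rw [Metric.mem_ball, dist_comm] at hy
  linarith [hx.2]

lemma isCompact_innerPart {d : ℕ} {U : Set (Fin d → ℝ)} (hU : IsOpen U)
    (hb : U ⊆ Icc 0 1) {ε : ℝ} (hε : 0 < ε) : IsCompact (innerPart U ε) := by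
  have heq : innerPart U ε = closure U ∩ {x | ε ≤ Metric.infDist x (frontier U)} := by
    ext x
    constructor
    · exact fun h => ⟨subset_closure h.1, h.2⟩
    · rintro ⟨h1, h2⟩
      refine ⟨?_, h2⟩
      by_contra hxU
      have hxf : x ∈ frontier U := by
        rw [hU.frontier_eq]; exact ⟨h1, hxU⟩
      have := Metric.infDist_zero_of_mem hxf
      have h2' : ε ≤ Metric.infDist x (frontier U) := h2
      linarith
  have hcl : closure U ⊆ Icc 0 1 := closure_minimal hb isClosed_Icc
  rw [heq]
  refine (isCompact_Icc (a := (0 : Fin d → ℝ)) (b := 1)).of_isClosed_subset ?_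
    (inter_subset_left.trans hcl)
  exact isClosed_closure.inter (isClosed_le continuous_const (Metric.continuous_infDist_pt _))

lemma matNorm_le_sum {n : ℕ} (A : Matrix (Fin n) (Fin n) ℝ) :
    matNorm A ≤ ∑ i, ∑ j, |A i j| := by
  have h : (Finset.univ.sup fun i => ∑ j, ‖A i j‖₊) ≤ ∑ i, ∑ j, ‖A i j‖₊ :=
    Finset.sup_le fun i _ => Finset.single_le_sum (f := fun i => ∑ j, ‖A i j‖₊)
      (fun _ _ => zero_le) (Finset.mem_univ i)
  have := NNReal.coe_le_coe.2 h
  simpa [matNorm] using this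

namespace PES

variable {d : ℕ} (S : PES d)

lemma parts_subset (k : ℕ) : S.parts k ⊆ Icc 0 1 :=
  (subset_iUnion _ k).trans (S.parts_union ▸ S.Ω_subset)

lemma finite_innerPart_nonempty {ε : ℝ} (hε : 0 < ε) :
    {k | (innerPart (S.parts k) ε).Nonempty}.Finite := by
  have hpos : 0 < volume (Metric.ball (0 : Fin d → ℝ) ε) := Metric.measure_ball_pos _ _ hε
  refine (Measure.finite_const_le_meas_of_disjoint_iUnion volume hpos
    (fun k => (S.parts_open k).measurableSet) S.parts_disj ?_).subset ?_
  · rw [S.parts_union]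
    exact ((measure_mono S.Ω_subset).trans_lt isCompact_Icc.measure_lt_top).ne
  · rintro k ⟨x, hx⟩
    have := measure_mono (μ := volume) (ball_subset_of_mem_innerPart hx)
    rwa [← Measure.addHaar_ball_center volume x ε]

lemma exists_bound_innerPart {ε : ℝ} (hε : 0 < ε) :
    ∃ C : ℝ, ∀ k, ∀ x ∈ innerPart (S.parts k) ε, ∀ j, matNorm (jacDj S.T j x) ≤ C := by
  have h1 : ∀ k, ∃ C : ℝ, ∀ x ∈ innerPart (S.parts k) ε, ∀ j, matNorm (jacDj S.T j x) ≤ C := by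
    intro k
    have hc : ContinuousOn (fun x => ∑ j, ∑ a, ∑ b, |jacDj S.T j x a b|)
        (innerPart (S.parts k) ε) := fun x hx => by
      refine ContinuousAt.continuousWithinAt ?_
      exact tendsto_finsetSum _ fun j _ => tendsto_finsetSum _ fun a _ =>
        tendsto_finsetSum _ fun b _ => (S.continuousAt_jacDj hx.1 j a b).abs
    obtain ⟨C, hC⟩ := (isCompact_innerPart (S.parts_open k) (S.parts_subset k)
      hε).bddAbove_image hc
    refine ⟨C, fun x hx j => (matNorm_le_sum _).trans
      (le_trans ?_ (hC (mem_image_of_mem _ hx)))⟩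
    exact Finset.single_le_sum (f := fun j => ∑ a, ∑ b, |jacDj S.T j x a b|)
      (fun j _ => Finset.sum_nonneg fun a _ => Finset.sum_nonneg fun b _ => abs_nonneg _)
      (Finset.mem_univ j)
  choose C hC using h1
  obtain ⟨B, hB⟩ := ((S.finite_innerPart_nonempty hε).image C).bddAbove
  exact ⟨B, fun k x hx j => (hC k x hx j).trans (hB (mem_image_of_mem _ ⟨x, hx⟩))⟩

lemma exists_layer {η : ℝ≥0∞} (hη : 0 < η) : ∃ ε : ℝ, 0 < ε ∧ ∀ (j : Fin d) (x : Fin d → ℝ),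
    ∑' k : ℕ, ∫⁻ y in Icc (0:ℝ) 1,
        indicator (bLayer (S.parts k) ε)
          (fun z => ENNReal.ofReal (matNorm (jacDj S.T j z)))
          (Function.update x j y) ≤ η := by
  have h : ∀ j : Fin d, ∀ᶠ ε in 𝓝[>] (0:ℝ), (⨆ x : Fin d → ℝ, ∑' k : ℕ, ∫⁻ y in Icc (0:ℝ) 1,
        indicator (bLayer (S.parts k) ε)
          (fun z => ENNReal.ofReal (matNorm (jacDj S.T j z)))
          (Function.update x j y)) ≤ η :=
    fun j => (S.h4 j).eventually_le_const hη
  obtain ⟨ε, h1, h2⟩ := ((eventually_all.2 h).and self_mem_nhdsWithin).exists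
  exact ⟨ε, h2, fun j x => (le_iSup _ x).trans (h1 j)⟩

lemma setOf_update_mem_Ω (j : Fin d) (x : Fin d → ℝ) :
    {y : ℝ | Function.update x j y ∈ S.Ω} = ⋃ p : ℕ × ℕ, S.Ifam j x p.1 p.2 := by
  have h := fun k => S.Ifam_union j x k
  ext y
  simp only [iUnion_prod', mem_iUnion, ← S.parts_union, Set.mem_ofPred_eq]
  refine exists_congr fun k => ?_
  have := Set.ext_iff.1 (h k) y
  simpa only [mem_iUnion, Set.mem_ofPred_eq] using this

lemma update_mem_parts {j : Fin d} {x : Fin d → ℝ} {k l : ℕ} {y : ℝ}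
    (hy : y ∈ S.Ifam j x k l) : Function.update x j y ∈ S.parts k := by
  have := Set.ext_iff.1 (S.Ifam_union j x k) y
  exact this.2 (mem_iUnion.2 ⟨l, hy⟩)

lemma Ifam_subset (j : Fin d) (x : Fin d → ℝ) (k l : ℕ) : S.Ifam j x k l ⊆ Icc 0 1 := by
  intro y hy
  have h := S.parts_subset k (S.update_mem_parts hy)
  have h0 := h.1 j
  have h1 := h.2 j
  simp only [Function.update_self] at h0 h1
  exact ⟨h0, h1⟩

lemma pairwise_disjoint_Ifam (j : Fin d) (x : Fin d → ℝ) :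
    Pairwise (Function.onFun Disjoint fun p : ℕ × ℕ => S.Ifam j x p.1 p.2) := by
  rintro ⟨k, l⟩ ⟨k', l'⟩ hne
  by_cases h : k = k'
  · subst h
    exact S.Ifam_disj j x k fun hl => hne (Prod.ext rfl hl)
  · refine disjoint_left.2 fun y hy hy' => ?_
    exact disjoint_left.1 (S.parts_disj h) (S.update_mem_parts hy) (S.update_mem_parts hy')

/-- The overlap bound of (H3) at every point of a line. -/
lemma tsum_Ifam_le (j : Fin d) (x : Fin d → ℝ) (y : ℝ) :
    (∑' p : ℕ × ℕ, if (Icc (y - S.δ) (y + S.δ) ∩ S.Ifam j x p.1 p.2).Nonempty then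
        ⨆ t ∈ S.Ifam j x p.1 p.2, ENNReal.ofReal (matNorm (jacInv S.T (Function.update x j t)))
      else 0) ≤ ENNReal.ofReal S.lam⁻¹ := by
  set c : ℝ := max 0 (min 1 y) with hc
  by_cases hx : Function.update x j c ∈ Icc (0 : Fin d → ℝ) 1
  · refine le_trans (ENNReal.tsum_le_tsum fun p => ?_) (S.h3 _ hx j)
    have hI : S.Ifam j (Function.update x j c) p.1 p.2 = S.Ifam j x p.1 p.2 :=
      S.Ifam_indep j _ _ _ _ fun i hi => by simp [hi]
    simp only [hI, Function.update_self, Function.update_idem]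
    by_cases h : (Icc (y - S.δ) (y + S.δ) ∩ S.Ifam j x p.1 p.2).Nonempty
    · have h' : (Icc (c - S.δ) (c + S.δ) ∩ S.Ifam j x p.1 p.2).Nonempty := by
        obtain ⟨z, hz, hzI⟩ := h
        have hz01 := S.Ifam_subset j x _ _ hzI
        have hδ := S.δ_pos
        refine ⟨z, ⟨?_, ?_⟩, hzI⟩
        · rcases le_total 1 y with h1 | h1 <;> rcases le_total 0 y with h0 | h0 <;>
            simp only [hc, min_eq_left h1, min_eq_right h1, max_eq_left h0, max_eq_right h0,
              max_eq_right (zero_le_one' ℝ)] <;> linarith [hz.1, hz.2, hz01.1, hz01.2]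
        · rcases le_total 1 y with h1 | h1 <;> rcases le_total 0 y with h0 | h0 <;>
            simp only [hc, min_eq_left h1, min_eq_right h1, max_eq_left h0, max_eq_right h0,
              max_eq_right (zero_le_one' ℝ)] <;> linarith [hz.1, hz.2, hz01.1, hz01.2]
      rw [if_pos h, if_pos h']
    · rw [if_neg h]; exact zero_le
  · have hempty : ∀ k l, S.Ifam j x k l = ∅ := by
      intro k l
      refine eq_empty_of_forall_notMem fun t ht => hx ?_
      have h := S.parts_subset k (S.update_mem_parts ht)
      have hc01 : 0 ≤ c ∧ c ≤ 1 := ⟨le_max_left _ _, max_le zero_le_one (min_le_left _ _)⟩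
      constructor <;> intro i
      · by_cases hi : i = j
        · subst hi; simpa using hc01.1
        · simpa [hi] using h.1 i
      · by_cases hi : i = j
        · subst hi; simpa using hc01.2
        · simpa [hi] using h.2 i
    simp [hempty]

end PES

namespace PES

variable {d : ℕ} (S : PES d)

lemma lintegral_distTerm_le {u u' : ℝ → ℝ} (hu : ∀ y, HasDerivAt u (u' y) y)
    (hu' : Continuous u') (huc : HasCompactSupport u) {φ : (Fin d → ℝ) → (Fin d → ℝ)}
    (hφ1 : ∀ x, ‖φ x‖ ≤ 1) (j : Fin d) (x : Fin d → ℝ)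
    {ε C : ℝ} {η : ℝ≥0∞}
    (hC : ∀ k, ∀ z ∈ innerPart (S.parts k) ε, matNorm (jacDj S.T j z) ≤ C)
    (hη : ∑' k : ℕ, ∫⁻ y in Icc (0:ℝ) 1,
        indicator (bLayer (S.parts k) ε)
          (fun z => ENNReal.ofReal (matNorm (jacDj S.T j z))) (Function.update x j y) ≤ η) :
    ∫⁻ y in {y | Function.update x j y ∈ S.Ω},
        ‖u y‖ₑ * ‖S.distTerm φ j (Function.update x j y)‖ₑ ≤
      η * (∫⁻ y, ‖u' y‖ₑ) + ENNReal.ofReal C * ∫⁻ y, ‖u y‖ₑ := by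
  set N : ℝ≥0∞ := ∫⁻ y, ‖u' y‖ₑ with hN
  have hucont : Continuous u := continuous_iff_continuousAt.2 fun y => (hu y).continuousAt
  have hcont : Continuous fun y => Function.update x j y := continuous_const.update j continuous_id
  set A : ℕ → Set ℝ := fun k => {y | Function.update x j y ∈ S.parts k} with hA
  have hAo : ∀ k, IsOpen (A k) := fun k => (S.parts_open k).preimage hcont
  have hAd : Pairwise (Function.onFun Disjoint A) := fun k l hkl =>
    (S.parts_disj hkl).preimage _
  have hAU : {y | Function.update x j y ∈ S.Ω} = ⋃ k, A k := by
    ext y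
    simp [hA, ← S.parts_union]
  have hA01 : ∀ k, A k ⊆ Icc 0 1 := by
    intro k y hy
    have h := S.parts_subset k hy
    have h0 := h.1 j
    have h1 := h.2 j
    simp only [Function.update_self] at h0 h1
    exact ⟨h0, h1⟩
  have hNtop : N ≠ ⊤ := by
    have hu'c : HasCompactSupport u' := by
      have : u' = deriv u := funext fun y => (hu y).deriv.symm
      rw [this]; exact huc.deriv
    exact (hu'.integrable_of_hasCompactSupport hu'c).2.ne
  rw [hAU, lintegral_iUnion (fun k => (hAo k).measurableSet) hAd]
  have hk : ∀ k, ∫⁻ y in A k, ‖u y‖ₑ * ‖S.distTerm φ j (Function.update x j y)‖ₑ ≤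
      ENNReal.ofReal C * (∫⁻ y in A k, ‖u y‖ₑ) + N * ∫⁻ y in Icc (0:ℝ) 1,
        indicator (bLayer (S.parts k) ε)
          (fun z => ENNReal.ofReal (matNorm (jacDj S.T j z))) (Function.update x j y) := by
    intro k
    calc ∫⁻ y in A k, ‖u y‖ₑ * ‖S.distTerm φ j (Function.update x j y)‖ₑ
        ≤ ∫⁻ y in A k, (ENNReal.ofReal C * ‖u y‖ₑ + N * indicator (bLayer (S.parts k) ε)
          (fun z => ENNReal.ofReal (matNorm (jacDj S.T j z))) (Function.update x j y)) := by
          refine setLIntegral_mono' (hAo k).measurableSet fun y hy => ?_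
          by_cases hb : Function.update x j y ∈ innerPart (S.parts k) ε
          · refine le_add_right ?_
            rw [mul_comm]
            gcongr
            exact (S.enorm_distTerm_le hφ1 j _).trans (ENNReal.ofReal_le_ofReal (hC k _ hb))
          · refine le_add_left ?_
            rw [indicator_of_mem (show _ ∈ bLayer (S.parts k) ε from ⟨hy, hb⟩)]
            exact mul_le_mul' (enorm_le_lintegral_deriv hu hu' huc y) (S.enorm_distTerm_le hφ1 j _)
      _ = ENNReal.ofReal C * (∫⁻ y in A k, ‖u y‖ₑ) + N * ∫⁻ y in A k,
          indicator (bLayer (S.parts k) ε)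
          (fun z => ENNReal.ofReal (matNorm (jacDj S.T j z))) (Function.update x j y) := by
          rw [lintegral_add_left ((hucont.enorm.measurable).const_mul _),
            lintegral_const_mul' _ _ ENNReal.ofReal_ne_top, lintegral_const_mul' _ _ hNtop]
      _ ≤ _ := by
          gcongr
          exact hA01 k
  refine (ENNReal.tsum_le_tsum hk).trans ?_
  rw [ENNReal.tsum_add, ENNReal.tsum_mul_left, ENNReal.tsum_mul_left, add_comm, mul_comm N,
    ← lintegral_iUnion (fun k => (hAo k).measurableSet) hAd]
  gcongr
  exact Measure.restrict_le_self

/-- The estimate of the `j`-th part of `∫ u (div φ) ∘ T` along a line. -/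
lemma slice_estimate {u u' : ℝ → ℝ} (hu : ∀ y, HasDerivAt u (u' y) y)
    (hu' : Continuous u') (huc : HasCompactSupport u) {φ : (Fin d → ℝ) → (Fin d → ℝ)}
    (hφ : ContDiff ℝ 1 φ) (hφ1 : ∀ x, ‖φ x‖ ≤ 1) (j : Fin d) (x : Fin d → ℝ)
    {ε C : ℝ} {η : ℝ≥0∞}
    (hC : ∀ k, ∀ z ∈ innerPart (S.parts k) ε, matNorm (jacDj S.T j z) ≤ C)
    (hη : ∑' k : ℕ, ∫⁻ y in Icc (0:ℝ) 1,
        indicator (bLayer (S.parts k) ε)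
          (fun z => ENNReal.ofReal (matNorm (jacDj S.T j z))) (Function.update x j y) ≤ η) :
    ENNReal.ofReal (∫ y in {y | Function.update x j y ∈ S.Ω},
        u y * S.divTerm φ j (Function.update x j y)) ≤
      (ENNReal.ofReal S.lam⁻¹ + η) * (∫⁻ y, ‖u' y‖ₑ) +
        (ENNReal.ofReal S.lam⁻¹ * ENNReal.ofReal S.δ⁻¹ + ENNReal.ofReal C) * ∫⁻ y, ‖u y‖ₑ := by
  by_cases hint : IntegrableOn (fun y => u y * S.divTerm φ j (Function.update x j y))
    {y | Function.update x j y ∈ S.Ω}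
  swap
  · rw [integral_undef hint]; simp
  have hcont : Continuous fun y => Function.update x j y := continuous_const.update j continuous_id
  have hmaps : ∀ p : ℕ × ℕ, MapsTo (fun y => Function.update x j y) (S.Ifam j x p.1 p.2)
      (S.parts p.1) := fun p y hy => S.update_mem_parts hy
  have hE := S.lintegral_distTerm_le hu hu' huc hφ1 j x hC hη
  rw [S.setOf_update_mem_Ω] at hint hE ⊢
  have key := ofReal_integral_iUnion_le (u := u) (u' := u')
    (ψ := fun y => S.pullback φ j (Function.update x j y))
    (F := fun y => S.divTerm φ j (Function.update x j y))
    (E := fun y => S.distTerm φ j (Function.update x j y))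
    hu hu' S.δ_pos (I := fun p : ℕ × ℕ => S.Ifam j x p.1 p.2)
    (fun p => S.Ifam_open _ _ _ _) (fun p => S.Ifam_conn _ _ _ _) (fun p => S.Ifam_subset _ _ _ _)
    (S.pairwise_disjoint_Ifam j x)
    (fun p y hy => S.hasDerivAt_pullback hφ j (S.update_mem_parts hy))
    (fun p => (S.continuousOn_divTerm hφ j p.1).comp hcont.continuousOn (hmaps p))
    (fun p => (S.continuousOn_distTerm hφ j p.1).comp hcont.continuousOn (hmaps p))
    (fun p y hy => (S.enorm_pullback_le hφ1 j _).trans (le_iSup₂ (f := fun t (_ : t ∈ S.Ifam j x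
      p.1 p.2) => ENNReal.ofReal (matNorm (jacInv S.T (Function.update x j t)))) y hy))
    ENNReal.ofReal_ne_top (S.tsum_Ifam_le j x) hint
  have hucont : Continuous u := continuous_iff_continuousAt.2 fun y => (hu y).continuousAt
  refine (key.trans (add_le_add_right hE _)).trans (le_of_eq ?_)
  rw [lintegral_add_left hu'.enorm.measurable, lintegral_const_mul' _ _ ENNReal.ofReal_ne_top]
  ring

end PES

lemma ofReal_integral_le_lintegral {α : Type*} [MeasurableSpace α] {μ : Measure α} (g : α → ℝ) :
    ENNReal.ofReal (∫ x, g x ∂μ) ≤ ∫⁻ x, ENNReal.ofReal (g x) ∂μ := by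
  by_cases hg : Integrable g μ
  · have h1 : ∫ x, g x ∂μ ≤ ∫ x, max (g x) 0 ∂μ :=
      integral_mono hg hg.pos_part fun x => le_max_left _ _
    refine (ENNReal.ofReal_le_ofReal h1).trans ?_
    rw [ofReal_integral_eq_lintegral_ofReal hg.pos_part (ae_of_all _ fun x => le_max_right _ _)]
    simp
  · rw [integral_undef hg]; simp

/-- Estimates along all the lines parallel to a coordinate axis can be integrated. -/
lemma ofReal_integral_le_of_slices {d : ℕ} (j : Fin d) {g : (Fin d → ℝ) → ℝ}
    {G : (Fin d → ℝ) → ℝ≥0∞} (hg : Integrable g) (hG : Measurable G)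
    (h : ∀ x, ENNReal.ofReal (∫ y, g (Function.update x j y)) ≤
      ∫⁻ y, G (Function.update x j y)) :
    ENNReal.ofReal (∫ x, g x) ≤ ∫⁻ x, G x := by
  obtain _ | n := d
  · exact j.elim0
  set e := (MeasurableEquiv.piFinSuccAbove (fun _ : Fin (n + 1) => ℝ) j).symm with he
  have hmp : MeasurePreserving e (volume.prod volume) volume :=
    (volume_preserving_piFinSuccAbove (fun _ : Fin (n + 1) => ℝ) j).symm _
  have hup : ∀ (y : ℝ) (z : Fin n → ℝ), e (y, z) =
      Function.update (j.insertNth (α := fun _ => ℝ) 0 z) j y := by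
    intro y z
    rw [Fin.update_insertNth]
    rfl
  have hgi : Integrable (fun p => g (e p)) (volume.prod volume) :=
    (hmp.integrable_comp_emb e.measurableEmbedding).2 hg
  rw [← hmp.integral_comp e.measurableEmbedding, ← hmp.lintegral_comp hG,
    integral_prod_symm _ hgi, lintegral_prod_symm' (fun p => G (e p)) (hG.comp e.measurable)]
  refine (ofReal_integral_le_lintegral _).trans (lintegral_mono fun z => ?_)
  simp only [hup]
  exact h _

lemma hasCompactSupport_update {d : ℕ} {u : (Fin d → ℝ) → ℝ} (hu : HasCompactSupport u)
    (x : Fin d → ℝ) (j : Fin d) : HasCompactSupport fun y => u (Function.update x j y) :=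
  hu.comp_isClosedEmbedding (isClosedEmbedding_update x j)

lemma hasDerivAt_comp_update {d : ℕ} {u : (Fin d → ℝ) → ℝ} (hu : ContDiff ℝ 1 u)
    (x : Fin d → ℝ) (j : Fin d) (y : ℝ) : HasDerivAt (fun y => u (Function.update x j y))
      (fderiv ℝ u (Function.update x j y) (Pi.single j 1)) y :=
  ((hu.differentiable (by norm_num) _).hasFDerivAt).comp_hasDerivAt y (hasDerivAt_update x j y)

namespace PES

variable {d : ℕ} (S : PES d)

lemma integrableOn_divTerm {φ : (Fin d → ℝ) → (Fin d → ℝ)} (hφ : IsTest d φ) (j : Fin d) :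
    IntegrableOn (S.divTerm φ j) S.Ω := by
  unfold divTerm
  refine integrable_finsetSum _ fun i _ => integrable_finsetSum _ fun k _ => ?_
  have h0 : Continuous fun x => fderiv ℝ φ x (Pi.single k 1) i :=
    (continuous_apply i).comp ((hφ.1.continuous_fderiv (by norm_num)).clm_apply continuous_const)
  have hc : HasCompactSupport fun x => fderiv ℝ φ x (Pi.single k 1) i :=
    (hφ.2.1.fderiv (𝕜 := ℝ)).comp_left
      (g := fun A : (Fin d → ℝ) →L[ℝ] (Fin d → ℝ) => A (Pi.single k 1) i) rfl
  obtain ⟨M, hM⟩ := h0.bounded_above_of_compact_support hc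
  refine (S.h5 i j k).bdd_mul (c := M) ?_ (ae_of_all _ fun x => hM _)
  rw [← S.parts_union]
  refine aestronglyMeasurable_iUnion_iff.2 fun l => ?_
  refine ContinuousOn.aestronglyMeasurable ?_ (S.parts_open l).measurableSet
  exact h0.comp_continuousOn (S.T_C2 l).continuousOn

/-- The key estimate against smooth functions. -/
lemma exists_smooth_estimate {η : ℝ≥0∞} (hη : 0 < η) : ∃ B : ℝ≥0∞, B ≠ ⊤ ∧
    ∀ φ, IsTest d φ → ∀ u : (Fin d → ℝ) → ℝ, ContDiff ℝ 1 u → HasCompactSupport u →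
      ENNReal.ofReal (∫ x in S.Ω, u x * divg φ (S.T x)) ≤
        (ENNReal.ofReal S.lam⁻¹ + η) * (∑ j, ∫⁻ x, ‖fderiv ℝ u x (Pi.single j 1)‖ₑ) +
          B * ∫⁻ x, ‖u x‖ₑ := by
  obtain ⟨ε, hε, hlayer⟩ := S.exists_layer hη
  obtain ⟨C, hC⟩ := S.exists_bound_innerPart hε
  refine ⟨d * (ENNReal.ofReal S.lam⁻¹ * ENNReal.ofReal S.δ⁻¹ + ENNReal.ofReal C), by finiteness,
    fun φ hφ u hu huc => ?_⟩
  obtain ⟨M, hM⟩ := hu.continuous.bounded_above_of_compact_support huc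
  have hint : ∀ j, IntegrableOn (fun x => u x * S.divTerm φ j x) S.Ω := fun j =>
    (S.integrableOn_divTerm hφ j).bdd_mul (c := M) hu.continuous.aestronglyMeasurable
      (ae_of_all _ fun x => hM x)
  have hsum : ∫ x in S.Ω, u x * divg φ (S.T x) =
      ∑ j, ∫ x in S.Ω, u x * S.divTerm φ j x := by
    rw [← integral_finsetSum _ fun j _ => hint j]
    refine setIntegral_congr_fun S.Ω_open.measurableSet fun x hx => ?_
    rw [← S.parts_union] at hx
    obtain ⟨k, hk⟩ := mem_iUnion.1 hx
    simp only [← S.sum_divTerm φ hk, Finset.mul_sum]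
  have hj : ∀ j, ENNReal.ofReal (∫ x in S.Ω, u x * S.divTerm φ j x) ≤
      (ENNReal.ofReal S.lam⁻¹ + η) * (∫⁻ x, ‖fderiv ℝ u x (Pi.single j 1)‖ₑ) +
        (ENNReal.ofReal S.lam⁻¹ * ENNReal.ofReal S.δ⁻¹ + ENNReal.ofReal C) * ∫⁻ x, ‖u x‖ₑ := by
    intro j
    have hcj : Continuous fun x => fderiv ℝ u x (Pi.single j 1) :=
      (hu.continuous_fderiv (by norm_num)).clm_apply continuous_const
    rw [← lintegral_const_mul _ hcj.enorm.measurable,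
      ← lintegral_const_mul _ hu.continuous.enorm.measurable,
      ← lintegral_add_left (hcj.enorm.measurable.const_mul _),
      ← integral_indicator S.Ω_open.measurableSet]
    refine ofReal_integral_le_of_slices j ((integrable_indicator_iff
      S.Ω_open.measurableSet).2 (hint j)) ((hcj.enorm.measurable.const_mul _).add
      (hu.continuous.enorm.measurable.const_mul _)) fun x => ?_
    have hup : Continuous fun y => Function.update x j y :=
      continuous_const.update j continuous_id
    have hm1 := (hcj.comp hup).enorm.measurable
    have hm2 := (hu.continuous.comp hup).enorm.measurable
    simp only [Function.comp_def] at hm1 hm2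
    rw [lintegral_add_left (hm1.const_mul _), lintegral_const_mul _ hm1,
      lintegral_const_mul _ hm2]
    refine le_trans (le_of_eq ?_) (S.slice_estimate (hasDerivAt_comp_update hu x j)
      (hcj.comp hup) (hasCompactSupport_update huc x j) hφ.1 hφ.2.2 j x
      (fun k z hz => hC k z hz j) (hlayer j x))
    exact congrArg _ (integral_indicator (S.Ω_open.preimage hup).measurableSet)
  rw [hsum]
  refine (ofReal_sum_le _ _).trans ((Finset.sum_le_sum fun j _ => hj j).trans (le_of_eq ?_))
  rw [Finset.sum_add_distrib, Finset.mul_sum]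
  simp [mul_assoc]

end PES

/-- The total variation of a smooth function is at least the `L¹` norm of its gradient. -/
lemma sum_lintegral_fderiv_le_bvNormE {d : ℕ} {u : (Fin d → ℝ) → ℝ} (hu : ContDiff ℝ 2 u)
    (huc : HasCompactSupport u) :
    ∑ j, ∫⁻ x, ‖fderiv ℝ u x (Pi.single j 1)‖ₑ ≤ bvNormE u := by
  have hf1 : ∀ j, ContDiff ℝ 1 fun x => fderiv ℝ u x (Pi.single j 1) := fun j =>
    (hu.fderiv_right (m := 1) (by norm_num)).clm_apply contDiff_const
  have hfc : ∀ j, HasCompactSupport fun x => fderiv ℝ u x (Pi.single j 1) := fun j =>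
    huc.fderiv_apply (𝕜 := ℝ) _
  have hfi : ∀ j, Integrable fun x => fderiv ℝ u x (Pi.single j 1) := fun j =>
    (hf1 j).continuous.integrable_of_hasCompactSupport (hfc j)
  set K := tsupport u
  have hKm : MeasurableSet K := (isClosed_tsupport u).measurableSet
  have hKfin : volume K < ⊤ := huc.isCompact.measure_lt_top
  set V : ℝ := volume.real K
  have hVpos : 0 ≤ V := measureReal_nonneg
  have hoff : ∀ j, ∀ x ∉ K, fderiv ℝ u x (Pi.single j 1) = 0 := fun j x hx => by
    rw [image_eq_zero_of_notMem_tsupport (f := fderiv ℝ u)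
      (fun h => hx (tsupport_fderiv_subset ℝ h))]
    rfl
  refine ENNReal.le_of_forall_pos_le_add fun ε hε _ => ?_
  obtain ⟨a, ha, haε⟩ : ∃ a : ℝ, 0 < a ∧ d * (a * V) ≤ ε := by
    refine ⟨ε / (d * V + 1), by positivity, ?_⟩
    have h1 : (0:ℝ) < d * V + 1 := by positivity
    have h2 : d * (ε / (d * V + 1) * V) = ε * (d * V / (d * V + 1)) := by ring
    rw [h2]
    exact mul_le_of_le_one_right ε.2 ((div_le_one h1).2 (by linarith))
  have hpos : ∀ j x, 0 < (fderiv ℝ u x (Pi.single j 1)) ^ 2 + a ^ 2 := fun j x => by positivity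
  set ψ : (Fin d → ℝ) → (Fin d → ℝ) := fun x j =>
    -(fderiv ℝ u x (Pi.single j 1) / √((fderiv ℝ u x (Pi.single j 1)) ^ 2 + a ^ 2)) with hψ
  have hψj : ∀ j, ContDiff ℝ 1 fun x => ψ x j := fun j =>
    ((hf1 j).div ((((hf1 j).pow 2).add contDiff_const).sqrt fun x => (hpos j x).ne')
      fun x => (Real.sqrt_pos.2 (hpos j x)).ne').neg
  have hψC : ContDiff ℝ 1 ψ := contDiff_pi.2 hψj
  have hψoff : ∀ x ∉ K, ψ x = 0 := fun x hx => by
    ext j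
    simp [hψ, hoff j x hx]
  have htest : IsTest d ψ := by
    refine ⟨hψC, HasCompactSupport.intro huc.isCompact hψoff, fun x => ?_⟩
    refine (pi_norm_le_iff_of_nonneg zero_le_one).2 fun j => ?_
    simp only [hψ, norm_neg, norm_div, Real.norm_eq_abs, abs_of_nonneg (Real.sqrt_nonneg _)]
    refine div_le_one_of_le₀ (Real.abs_le_sqrt (by nlinarith)) (Real.sqrt_nonneg _)
  have hu1 : ContDiff ℝ 1 u := hu.of_le (by norm_num)
  have hdψ : ∀ j x, fderiv ℝ ψ x (Pi.single j 1) j =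
      fderiv ℝ (fun x => ψ x j) x (Pi.single j 1) := fun j x => by
    rw [fderiv_apply (hψC.differentiable (by norm_num) x)]
    rfl
  have hdc : ∀ j, Continuous fun x => fderiv ℝ (fun x => ψ x j) x (Pi.single j 1) := fun j =>
    ((hψj j).continuous_fderiv (by norm_num)).clm_apply continuous_const
  have hi1 : ∀ j, Integrable fun x => u x * fderiv ℝ (fun x => ψ x j) x (Pi.single j 1) :=
    fun j => (hu.continuous.mul (hdc j)).integrable_of_hasCompactSupport huc.mul_right
  have hi2 : ∀ j, Integrable fun x => fderiv ℝ u x (Pi.single j 1) * ψ x j :=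
    fun j => ((hf1 j).continuous.mul (hψj j).continuous).integrable_of_hasCompactSupport
      (hfc j).mul_right
  have hi3 : ∀ j, Integrable fun x => u x * ψ x j :=
    fun j => (hu.continuous.mul (hψj j).continuous).integrable_of_hasCompactSupport huc.mul_right
  have hparts : ∀ j, ∫ x, u x * fderiv ℝ (fun x => ψ x j) x (Pi.single j 1) =
      ∫ x, -(fderiv ℝ u x (Pi.single j 1) * ψ x j) := fun j => by
    rw [integral_neg]
    exact integral_mul_fderiv_eq_neg_fderiv_mul_of_integrable (hi2 j) (hi1 j) (hi3 j)
      (fun x _ => hu1.differentiable (by norm_num) x)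
      (fun x _ => (hψj j).differentiable (by norm_num) x)
  have hlow : ∀ j, ∫ x, |fderiv ℝ u x (Pi.single j 1)| ≤
      (∫ x, u x * fderiv ℝ (fun x => ψ x j) x (Pi.single j 1)) + a * V := fun j => by
    have hKi : Integrable (K.indicator fun _ => a) :=
      (integrable_indicator_iff hKm).2 (integrableOn_const hKfin.ne)
    have hKa : ∫ x, K.indicator (fun _ => a) x = a * V := by
      rw [integral_indicator hKm, setIntegral_const, smul_eq_mul, mul_comm]
    have hi4 : Integrable fun x => -(fderiv ℝ u x (Pi.single j 1) * ψ x j) := (hi2 j).neg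
    rw [hparts j, ← hKa, ← integral_add hi4 hKi]
    refine integral_mono (hfi j).abs (hi4.add hKi) fun x => ?_
    by_cases hx : x ∈ K
    · simp only [hψ, indicator_of_mem hx]
      set f := fderiv ℝ u x (Pi.single j 1)
      have hs : 0 < √(f ^ 2 + a ^ 2) := Real.sqrt_pos.2 (hpos j x)
      have h1 : √(f ^ 2 + a ^ 2) ≤ |f| + a :=
        (Real.sqrt_le_left (by positivity)).2 (by nlinarith [sq_abs f, abs_nonneg f])
      have h2 : √(f ^ 2 + a ^ 2) ^ 2 = f ^ 2 + a ^ 2 := Real.sq_sqrt (hpos j x).le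
      have h3 : |f| ≤ √(f ^ 2 + a ^ 2) := Real.abs_le_sqrt (by nlinarith)
      have h4 : -(f * -(f / √(f ^ 2 + a ^ 2))) = f ^ 2 / √(f ^ 2 + a ^ 2) := by ring
      rw [h4, ← sub_le_iff_le_add, le_div_iff₀ hs]
      nlinarith [sq_abs f, abs_nonneg f]
    · simp [hoff j x hx, hx]
  have htot : ∑ j, ∫ x, |fderiv ℝ u x (Pi.single j 1)| ≤ (∫ x, u x * divg ψ x) + ε := by
    refine (Finset.sum_le_sum fun j _ => hlow j).trans ?_
    rw [Finset.sum_add_distrib, ← integral_finsetSum _ fun j _ => hi1 j]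
    simp only [divg, hdψ, Finset.mul_sum, Finset.sum_const, Finset.card_univ, Fintype.card_fin,
      nsmul_eq_mul]
    linarith
  have hE : ∑ j, ∫⁻ x, ‖fderiv ℝ u x (Pi.single j 1)‖ₑ =
      ENNReal.ofReal (∑ j, ∫ x, |fderiv ℝ u x (Pi.single j 1)|) := by
    rw [ENNReal.ofReal_sum_of_nonneg fun j _ => integral_nonneg fun x => abs_nonneg _]
    exact Finset.sum_congr rfl fun j _ => (ofReal_integral_norm_eq_lintegral_enorm (hfi j)).symm
  rw [hE]
  refine (ENNReal.ofReal_le_ofReal htot).trans (ENNReal.ofReal_add_le.trans ?_)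
  rw [ENNReal.ofReal_coe_nnreal]
  gcongr
  exact le_iSup (fun φ : {φ : (Fin d → ℝ) → (Fin d → ℝ) // IsTest d φ} =>
    ENNReal.ofReal (∫ x, u x * divg φ.1 x)) ⟨ψ, htest⟩

section Smoothing

variable {d : ℕ} {E : Type*} [NormedAddCommGroup E] [NormedSpace ℝ E]

/-- Convolution with a normalized smooth bump function. -/
def smoothing (b : ContDiffBump (0 : Fin d → ℝ)) (g : (Fin d → ℝ) → E) : (Fin d → ℝ) → E :=
  convolution (b.normed volume) g (ContinuousLinearMap.lsmul ℝ ℝ) volume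

lemma smoothing_apply (b : ContDiffBump (0 : Fin d → ℝ)) (g : (Fin d → ℝ) → E) (x : Fin d → ℝ) :
    smoothing b g x = ∫ t, b.normed volume t • g (x - t) := rfl

lemma smoothing_apply' (b : ContDiffBump (0 : Fin d → ℝ)) (g : (Fin d → ℝ) → E) (x : Fin d → ℝ) :
    smoothing b g x = ∫ t, b.normed volume (x - t) • g t := convolution_eq_swap _

lemma contDiff_smoothing (b : ContDiffBump (0 : Fin d → ℝ)) {g : (Fin d → ℝ) → E}
    (hg : LocallyIntegrable g) (n : ℕ∞) : ContDiff ℝ n (smoothing b g) :=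
  b.hasCompactSupport_normed.contDiff_convolution_left _ b.contDiff_normed hg

lemma hasCompactSupport_smoothing (b : ContDiffBump (0 : Fin d → ℝ)) {g : (Fin d → ℝ) → E}
    (hg : HasCompactSupport g) : HasCompactSupport (smoothing b g) :=
  b.hasCompactSupport_normed.convolution _ hg

lemma norm_smoothing_le (b : ContDiffBump (0 : Fin d → ℝ)) {g : (Fin d → ℝ) → E} {M : ℝ}
    (hg : ∀ x, ‖g x‖ ≤ M) (x : Fin d → ℝ) : ‖smoothing b g x‖ ≤ M := by
  rw [smoothing_apply]
  have h1 : ∫ t, b.normed volume t * M = M := by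
    rw [integral_mul_const, b.integral_normed, one_mul]
  rw [← h1]
  refine norm_integral_le_of_norm_le (b.integrable_normed.mul_const M) (ae_of_all _ fun t => ?_)
  rw [norm_smul, Real.norm_of_nonneg (b.nonneg_normed t)]
  exact mul_le_mul_of_nonneg_left (hg _) (b.nonneg_normed t)

lemma isTest_smoothing (b : ContDiffBump (0 : Fin d → ℝ)) {ψ : (Fin d → ℝ) → (Fin d → ℝ)}
    (hψ : IsTest d ψ) : IsTest d (smoothing b ψ) :=
  ⟨contDiff_smoothing b hψ.1.continuous.locallyIntegrable 1,
    hasCompactSupport_smoothing b hψ.2.1, norm_smoothing_le b hψ.2.2⟩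

lemma continuous_divg {ψ : (Fin d → ℝ) → (Fin d → ℝ)} (hψ : ContDiff ℝ 1 ψ) :
    Continuous (divg ψ) :=
  continuous_finsetSum _ fun j _ => (continuous_apply j).comp
    ((hψ.continuous_fderiv (by norm_num)).clm_apply continuous_const)

lemma hasCompactSupport_divg {ψ : (Fin d → ℝ) → (Fin d → ℝ)} (hψ : HasCompactSupport ψ) :
    HasCompactSupport (divg ψ) :=
  (hψ.fderiv (𝕜 := ℝ)).comp_left
    (g := fun A : (Fin d → ℝ) →L[ℝ] (Fin d → ℝ) => ∑ j, A (Pi.single j 1) j) (by simp)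

lemma IsTest.exists_bound_divg {ψ : (Fin d → ℝ) → (Fin d → ℝ)} (hψ : IsTest d ψ) :
    ∃ M, ∀ x, ‖divg ψ x‖ ≤ M :=
  (continuous_divg hψ.1).bounded_above_of_compact_support (hasCompactSupport_divg hψ.2.1)

lemma divg_smoothing (b : ContDiffBump (0 : Fin d → ℝ)) {ψ : (Fin d → ℝ) → (Fin d → ℝ)}
    (hψ : IsTest d ψ) (x : Fin d → ℝ) : divg (smoothing b ψ) x = smoothing b (divg ψ) x := by
  have hD : fderiv ℝ (smoothing b ψ) x = ∫ t, b.normed volume t • fderiv ℝ ψ (x - t) :=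
    (hψ.2.1.hasFDerivAt_convolution_right (ContinuousLinearMap.lsmul ℝ ℝ)
      (b.integrable_normed (μ := volume)).locallyIntegrable hψ.1 x).fderiv
  have hcf : Continuous (fderiv ℝ ψ) := hψ.1.continuous_fderiv (by norm_num)
  have hi : Integrable fun t => b.normed volume t • fderiv ℝ ψ (x - t) :=
    ((b.continuous_normed (μ := volume)).smul
      (hcf.comp (continuous_const.sub continuous_id))).integrable_of_hasCompactSupport
      b.hasCompactSupport_normed.smul_right
  have hj : ∀ j : Fin d, (∫ t, b.normed volume t • fderiv ℝ ψ (x - t)) (Pi.single j 1) j =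
      ∫ t, b.normed volume t • fderiv ℝ ψ (x - t) (Pi.single j 1) j := fun j =>
    (ContinuousLinearMap.integral_comp_comm
      ((ContinuousLinearMap.proj (R := ℝ) (φ := fun _ : Fin d => ℝ) j).comp
        (ContinuousLinearMap.apply ℝ (Fin d → ℝ) (Pi.single j (1:ℝ) : Fin d → ℝ))) hi).symm
  have hij : ∀ j : Fin d, Integrable
      fun t => b.normed volume t • fderiv ℝ ψ (x - t) (Pi.single j 1) j := fun j =>
    (ContinuousLinearMap.integrable_comp
      ((ContinuousLinearMap.proj (R := ℝ) (φ := fun _ : Fin d => ℝ) j).comp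
        (ContinuousLinearMap.apply ℝ (Fin d → ℝ) (Pi.single j (1:ℝ) : Fin d → ℝ))) hi)
  rw [smoothing_apply]
  simp only [divg, hD, hj, Finset.smul_sum]
  exact (integral_finsetSum _ fun j _ => hij j).symm

lemma integrable_smoothing_integrand (b : ContDiffBump (0 : Fin d → ℝ)) {g w : (Fin d → ℝ) → ℝ}
    (hg : Integrable g) (hw : AEStronglyMeasurable w) {M : ℝ} (hM : ∀ x, ‖w x‖ ≤ M) :
    Integrable (Function.uncurry fun x t => b.normed volume (x - t) * g t * w x)
      (volume.prod volume) := by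
  have h1 := hg.convolution_integrand (ContinuousLinearMap.lsmul ℝ ℝ)
    (b.integrable_normed (μ := volume))
  have h2 : Integrable (fun p : (Fin d → ℝ) × (Fin d → ℝ) =>
      b.normed volume (p.1 - p.2) * g p.2) (volume.prod volume) := by
    refine h1.congr (ae_of_all _ fun p => ?_)
    simp [mul_comm]
  exact h2.mul_bdd (c := M) hw.comp_fst (ae_of_all _ fun p => hM p.1)

/-- Smoothing is symmetric. -/
lemma integral_smoothing_mul (b : ContDiffBump (0 : Fin d → ℝ)) {g w : (Fin d → ℝ) → ℝ}
    (hg : Integrable g) (hw : AEStronglyMeasurable w) {M : ℝ} (hM : ∀ x, ‖w x‖ ≤ M) :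
    ∫ x, smoothing b g x * w x = ∫ x, g x * smoothing b w x := by
  simp only [smoothing_apply', ← integral_mul_const, ← integral_const_mul, smul_eq_mul]
  rw [integral_integral_swap (integrable_smoothing_integrand b hg hw hM)]
  refine integral_congr_ae (ae_of_all _ fun t => integral_congr_ae (ae_of_all _ fun x => ?_))
  simp only
  rw [← neg_sub t x, b.normed_neg]
  ring

lemma lintegral_smoothing_le (b : ContDiffBump (0 : Fin d → ℝ)) {g : (Fin d → ℝ) → ℝ}
    (hg : Integrable g) : ∫⁻ x, ‖smoothing b g x‖ₑ ≤ ∫⁻ x, ‖g x‖ₑ := by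
  have hi := integrable_smoothing_integrand b hg (w := fun _ => 1)
    aestronglyMeasurable_const (M := 1) (by simp)
  have hm : AEMeasurable (Function.uncurry fun x t => ‖b.normed volume (x - t) * g t‖ₑ)
      (volume.prod volume) := by
    refine hi.aestronglyMeasurable.enorm.congr (ae_of_all _ fun p => ?_)
    simp [Function.uncurry]
  calc ∫⁻ x, ‖smoothing b g x‖ₑ ≤ ∫⁻ x, ∫⁻ t, ‖b.normed volume (x - t) * g t‖ₑ := by
        refine lintegral_mono fun x => ?_
        rw [smoothing_apply']
        exact enorm_integral_le_lintegral_enorm _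
    _ = ∫⁻ t, ∫⁻ x, ‖b.normed volume (x - t) * g t‖ₑ := lintegral_lintegral_swap hm
    _ = ∫⁻ t, ‖g t‖ₑ := by
        refine lintegral_congr fun t => ?_
        simp only [enorm_mul]
        rw [lintegral_mul_const' _ _ enorm_ne_top,
          lintegral_sub_right_eq_self (fun x => ‖b.normed volume x‖ₑ) t,
          ← ofReal_integral_norm_eq_lintegral_enorm b.integrable_normed]
        simp only [Real.norm_of_nonneg (b.nonneg_normed _)]
        rw [b.integral_normed, ENNReal.ofReal_one, one_mul]

lemma bvNormE_smoothing_le (b : ContDiffBump (0 : Fin d → ℝ)) {g : (Fin d → ℝ) → ℝ}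
    (hg : Integrable g) : bvNormE (smoothing b g) ≤ bvNormE g := by
  refine iSup_le fun ψ => ?_
  obtain ⟨M, hM⟩ := ψ.2.exists_bound_divg
  rw [integral_smoothing_mul b hg (continuous_divg ψ.2.1).aestronglyMeasurable hM]
  simp only [← divg_smoothing b ψ.2]
  exact le_iSup (fun φ : {φ : (Fin d → ℝ) → (Fin d → ℝ) // IsTest d φ} =>
    ENNReal.ofReal (∫ x, g x * divg φ.1 x)) ⟨_, isTest_smoothing b ψ.2⟩

/-- An inequality between a bounded linear functional and the `W^{1,1}` norm which holds for
smooth functions extends to functions of bounded variation. -/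
lemma ofReal_integral_mul_le_of_smooth {w : (Fin d → ℝ) → ℝ} (hw : AEStronglyMeasurable w)
    {M : ℝ} (hM : ∀ x, ‖w x‖ ≤ M) {a b : ℝ≥0∞}
    (h : ∀ u : (Fin d → ℝ) → ℝ, ContDiff ℝ 2 u → HasCompactSupport u →
      ENNReal.ofReal (∫ x, u x * w x) ≤
        a * (∑ j, ∫⁻ x, ‖fderiv ℝ u x (Pi.single j 1)‖ₑ) + b * ∫⁻ x, ‖u x‖ₑ)
    {g : (Fin d → ℝ) → ℝ} (hg : Integrable g) (hgc : HasCompactSupport g) :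
    ENNReal.ofReal (∫ x, g x * w x) ≤ a * bvNormE g + b * ∫⁻ x, ‖g x‖ₑ := by
  have hwl : LocallyIntegrable w := (memLp_top_of_bound hw M (ae_of_all _ hM)).locallyIntegrable
    le_top
  set β : ℕ → ContDiffBump (0 : Fin d → ℝ) := fun n =>
    ⟨1 / ((n:ℝ) + 1), 2 / ((n:ℝ) + 1), by positivity, by gcongr; norm_num⟩ with hβ
  have hlim : Tendsto (fun n => (β n).rOut) atTop (𝓝 0) := by
    have := (tendsto_one_div_add_atTop_nhds_zero_nat (𝕜 := ℝ)).const_mul 2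
    simpa [hβ, div_eq_mul_inv] using this
  have hae := ContDiffBump.ae_convolution_tendsto_right_of_locallyIntegrable (μ := volume)
    (φ := β) (K := 2) hlim (Eventually.of_forall fun n => by simp [hβ, div_eq_mul_inv]) hwl
  have hDCT : Tendsto (fun n => ∫ x, g x * smoothing (β n) w x) atTop (𝓝 (∫ x, g x * w x)) := by
    refine tendsto_integral_of_dominated_convergence (fun x => ‖g x‖ * M) (fun n => ?_)
      (hg.norm.mul_const M) (fun n => ae_of_all _ fun x => ?_) ?_
    · exact hg.aestronglyMeasurable.mul
        (contDiff_smoothing (β n) hwl 0).continuous.aestronglyMeasurable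
    · rw [norm_mul]
      exact mul_le_mul_of_nonneg_left (norm_smoothing_le _ hM x) (norm_nonneg _)
    · filter_upwards [hae] with x hx
      exact hx.const_mul _
  refine le_of_tendsto' ((ENNReal.continuous_ofReal.tendsto _).comp hDCT) fun n => ?_
  have hu2 : ContDiff ℝ 2 (smoothing (β n) g) := contDiff_smoothing (β n) hg.locallyIntegrable 2
  have huc := hasCompactSupport_smoothing (β n) hgc
  simp only [Function.comp_apply]
  rw [← integral_smoothing_mul (β n) hg hw hM]
  refine (h _ hu2 huc).trans ?_
  refine add_le_add (mul_le_mul' le_rfl ?_) (mul_le_mul' le_rfl ?_)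
  · exact (sum_lintegral_fderiv_le_bvNormE hu2 huc).trans (bvNormE_smoothing_le _ hg)
  · exact lintegral_smoothing_le _ hg

end Smoothing

namespace PES

variable {d : ℕ} (S : PES d)

/-- The inverse branch of `T` on `T(Ω_k)`. -/
def branch (k : ℕ) : (Fin d → ℝ) → (Fin d → ℝ) := (S.T_inv k).choose

lemma branch_T {k : ℕ} {x : Fin d → ℝ} (hx : x ∈ S.parts k) : S.branch k (S.T x) = x :=
  (S.T_inv k).choose_spec.2 x hx

lemma injOn_T (k : ℕ) : InjOn S.T (S.parts k) := fun x hx y hy h => by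
  rw [← S.branch_T hx, h, S.branch_T hy]

lemma measurableSet_image (k : ℕ) : MeasurableSet (S.T '' S.parts k) :=
  measurable_image_of_fderivWithin (S.parts_open k).measurableSet
    (fun _ hx => (S.hasFDerivAt_T hx).hasFDerivWithinAt) (S.injOn_T k)

/-- The contribution of `Ω_k` to the transfer operator. -/
def branchTerm (f : (Fin d → ℝ) → ℝ) (k : ℕ) : (Fin d → ℝ) → ℝ :=
  (S.T '' S.parts k).indicator fun x => |(jac S.T (S.branch k x)).det|⁻¹ * f (S.branch k x)

lemma transferOp_eq_tsum (f : (Fin d → ℝ) → ℝ) (x : Fin d → ℝ) :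
    transferOp S.Ω S.T f x = ∑' k, S.branchTerm f k x := by
  have hmem : ∀ k : {k | x ∈ S.T '' S.parts k},
      S.branch k x ∈ S.parts k ∧ S.T (S.branch k x) = x := by
    rintro ⟨k, y, hy, rfl⟩
    rw [S.branch_T hy]
    exact ⟨hy, rfl⟩
  set e : {k | x ∈ S.T '' S.parts k} → ↥(S.Ω ∩ S.T ⁻¹' {x}) := fun k =>
    ⟨S.branch k x, S.parts_union ▸ mem_iUnion.2 ⟨k, (hmem k).1⟩, (hmem k).2⟩ with he
  have hbij : Function.Bijective e := by
    constructor
    · intro k l hkl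
      by_contra hne
      have h1 : S.branch k x = S.branch l x := congrArg Subtype.val hkl
      exact disjoint_left.1 (S.parts_disj fun h => hne (Subtype.ext h)) (hmem k).1
        (h1 ▸ (hmem l).1)
    · rintro ⟨y, hyΩ, hyx⟩
      rw [← S.parts_union] at hyΩ
      obtain ⟨k, hk⟩ := mem_iUnion.1 hyΩ
      have hyx' : S.T y = x := hyx
      refine ⟨⟨k, y, hk, hyx'⟩, Subtype.ext ?_⟩
      simp only [he, ← hyx']
      exact S.branch_T hk
  have h2 : ∀ k, S.branchTerm f k x = {k | x ∈ S.T '' S.parts k}.indicator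
      (fun k => |(jac S.T (S.branch k x)).det|⁻¹ * f (S.branch k x)) k := fun k => rfl
  simp only [transferOp, h2]
  rw [← tsum_subtype, ← (Equiv.ofBijective e hbij).tsum_eq]
  rfl

lemma branch_change_of_variables (f : (Fin d → ℝ) → ℝ) (k : ℕ)
    (hf : IntegrableOn f (S.parts k)) :
    Integrable (S.branchTerm f k) ∧ ∫ x, S.branchTerm f k x = ∫ x in S.parts k, f x := by
  have hd : ∀ x ∈ S.parts k, HasFDerivWithinAt S.T (fderiv ℝ S.T x) (S.parts k) x :=
    fun x hx => (S.hasFDerivAt_T hx).hasFDerivWithinAt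
  have hms := (S.parts_open k).measurableSet
  have heq : EqOn f (fun x => |(fderiv ℝ S.T x).det| •
      (|(jac S.T (S.branch k (S.T x))).det|⁻¹ * f (S.branch k (S.T x)))) (S.parts k) := by
    intro x hx
    have hne : |(jac S.T x).det| ≠ 0 := abs_ne_zero.2 (S.det_jac_ne_zero hx)
    simp only [S.branch_T hx, ← det_jac, smul_eq_mul]
    field_simp
  constructor
  · refine (integrable_indicator_iff (S.measurableSet_image k)).2 ?_
    rw [integrableOn_image_iff_integrableOn_abs_det_fderiv_smul volume hms hd (S.injOn_T k)]
    exact hf.congr_fun heq hms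
  · unfold branchTerm
    rw [integral_indicator (S.measurableSet_image k),
      integral_image_eq_integral_abs_det_fderiv_smul volume hms hd (S.injOn_T k)]
    exact (setIntegral_congr_fun hms heq).symm

lemma norm_branchTerm (f : (Fin d → ℝ) → ℝ) (k : ℕ) (x : Fin d → ℝ) :
    ‖S.branchTerm f k x‖ = S.branchTerm (fun x => ‖f x‖) k x := by
  unfold branchTerm
  rw [norm_indicator_eq_indicator_norm]
  simp

lemma branchTerm_mul (f ψ : (Fin d → ℝ) → ℝ) (k : ℕ) (x : Fin d → ℝ) :
    S.branchTerm f k x * ψ x = S.branchTerm (fun x => f x * ψ (S.T x)) k x := by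
  unfold branchTerm
  by_cases hx : x ∈ S.T '' S.parts k
  · obtain ⟨y, hy, rfl⟩ := hx
    have hx : S.T y ∈ S.T '' S.parts k := mem_image_of_mem _ hy
    simp only [indicator_of_mem hx, S.branch_T hy, mul_assoc]
  · simp [hx]

lemma integrableOn_parts {f : (Fin d → ℝ) → ℝ} (hf : IntegrableOn f S.Ω) (k : ℕ) :
    IntegrableOn f (S.parts k) :=
  hf.mono_set (S.parts_union ▸ subset_iUnion _ k)

lemma lintegral_transferOp_le {f : (Fin d → ℝ) → ℝ} (hf : IntegrableOn f S.Ω) :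
    ∫⁻ x, ‖transferOp S.Ω S.T f x‖ₑ ≤ ∫⁻ x in S.Ω, ‖f x‖ₑ := by
  have hk : ∀ k, ∫⁻ x, ‖S.branchTerm f k x‖ₑ = ∫⁻ x in S.parts k, ‖f x‖ₑ := fun k => by
    have hfk := S.integrableOn_parts hf k
    rw [← ofReal_integral_norm_eq_lintegral_enorm (S.branch_change_of_variables f k hfk).1,
      ← ofReal_integral_norm_eq_lintegral_enorm hfk]
    simp only [norm_branchTerm]
    rw [(S.branch_change_of_variables _ k hfk.norm).2]
  calc ∫⁻ x, ‖transferOp S.Ω S.T f x‖ₑ ≤ ∫⁻ x, ∑' k, ‖S.branchTerm f k x‖ₑ :=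
        lintegral_mono fun x => by
          rw [transferOp_eq_tsum]
          exact enorm_tsum_le_tsum_enorm
    _ = ∑' k, ∫⁻ x in S.parts k, ‖f x‖ₑ := by
        rw [lintegral_tsum fun k => (S.branch_change_of_variables f k
          (S.integrableOn_parts hf k)).1.aestronglyMeasurable.enorm]
        simp only [hk]
    _ = ∫⁻ x in S.Ω, ‖f x‖ₑ := by
        rw [← S.parts_union, lintegral_iUnion (fun k => (S.parts_open k).measurableSet)
          S.parts_disj]

lemma integrable_transferOp {f : (Fin d → ℝ) → ℝ} (hf : IntegrableOn f S.Ω) :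
    Integrable (transferOp S.Ω S.T f) := by
  refine ⟨?_, (S.lintegral_transferOp_le hf).trans_lt hf.2⟩
  have : transferOp S.Ω S.T f = fun x => ∑' k, S.branchTerm f k x :=
    funext (S.transferOp_eq_tsum f)
  rw [this]
  exact (AEMeasurable.tsum fun k => (S.branch_change_of_variables f k
    (S.integrableOn_parts hf k)).1.aestronglyMeasurable.aemeasurable).aestronglyMeasurable

/-- Duality between the transfer operator and composition with `T`. -/
lemma integral_transferOp_mul {f ψ : (Fin d → ℝ) → ℝ}
    (hfψ : IntegrableOn (fun x => f x * ψ (S.T x)) S.Ω) :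
    ∫ x, transferOp S.Ω S.T f x * ψ x = ∫ x in S.Ω, f x * ψ (S.T x) := by
  have hi := fun k => S.branch_change_of_variables _ k (S.integrableOn_parts hfψ k)
  have hn := fun k => S.branch_change_of_variables _ k (S.integrableOn_parts hfψ.norm k)
  have hΩ : ∀ g : (Fin d → ℝ) → ℝ, IntegrableOn g S.Ω →
      HasSum (fun k => ∫ x in S.parts k, g x) (∫ x in S.Ω, g x) := fun g hg => by
    rw [← S.parts_union] at hg ⊢
    exact hasSum_integral_iUnion (fun k => (S.parts_open k).measurableSet) S.parts_disj hg
  have hsum := hasSum_integral_of_summable_integral_norm (fun k => (hi k).1) (by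
    simp only [norm_branchTerm, (hn _).2]
    exact (hΩ _ hfψ.norm).summable)
  simp only [(hi _).2] at hsum
  rw [(hΩ _ hfψ).unique hsum]
  refine integral_congr_ae (ae_of_all _ fun x => ?_)
  simp only [transferOp_eq_tsum, ← tsum_mul_right, branchTerm_mul]

end PES

namespace PES

variable {d : ℕ} (S : PES d)

lemma ae_T_mem : ∀ᵐ x ∂volume.restrict S.Ω, S.T x ∈ S.Ω := by
  have h0 : ∀ᵐ x, S.T x ∉ frontier S.Ω := by
    have h1 := S.h0 1
    rw [Function.iterate_one] at h1
    exact measure_eq_zero_iff_ae_notMem.1 h1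
  filter_upwards [ae_restrict_of_ae h0, ae_restrict_mem S.Ω_open.measurableSet] with x hx hxΩ
  by_contra h
  exact hx (S.Ω_open.frontier_eq ▸ ⟨S.T_maps hxΩ, h⟩)

lemma aestronglyMeasurable_comp_T {g : (Fin d → ℝ) → ℝ} (hg : Continuous g) :
    AEStronglyMeasurable (fun x => g (S.T x)) (volume.restrict S.Ω) := by
  rw [← S.parts_union]
  exact aestronglyMeasurable_iUnion_iff.2 fun k =>
    (hg.comp_continuousOn (S.T_C2 k).continuousOn).aestronglyMeasurable
      (S.parts_open k).measurableSet

lemma integral_indicator_transferOp_mul {f g : (Fin d → ℝ) → ℝ} (hf : IntegrableOn f S.Ω)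
    (hg : Continuous g) {M : ℝ} (hM : ∀ x, ‖g x‖ ≤ M) :
    ∫ x, S.Ω.indicator (transferOp S.Ω S.T f) x * g x = ∫ x in S.Ω, f x * g (S.T x) := by
  have hae : (fun x => f x * S.Ω.indicator g (S.T x)) =ᵐ[volume.restrict S.Ω]
      fun x => f x * g (S.T x) := by
    filter_upwards [S.ae_T_mem] with x hx
    rw [indicator_of_mem hx]
  have hi : IntegrableOn (fun x => f x * g (S.T x)) S.Ω :=
    hf.mul_bdd (c := M) (S.aestronglyMeasurable_comp_T hg) (ae_of_all _ fun x => hM _)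
  rw [← integral_congr_ae hae, ← S.integral_transferOp_mul (hi.congr hae.symm)]
  refine integral_congr_ae (ae_of_all _ fun x => ?_)
  by_cases hx : x ∈ S.Ω <;> simp [hx]

lemma exists_bvNormOnE_transferOp_le {σ : ℝ} (hσ : S.lam⁻¹ < σ) : ∃ B : ℝ≥0∞, B ≠ ⊤ ∧
    ∀ f : (Fin d → ℝ) → ℝ, IntegrableOn f S.Ω →
      bvNormOnE S.Ω (transferOp S.Ω S.T f) ≤
        ENNReal.ofReal σ * bvNormOnE S.Ω f + B * ∫⁻ x in S.Ω, ‖f x‖ₑ := by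
  obtain ⟨B, hB, h⟩ := S.exists_smooth_estimate (ENNReal.ofReal_pos.2 (sub_pos.2 hσ))
  have hΩ := S.Ω_open.measurableSet
  have hlam : 0 ≤ S.lam⁻¹ := inv_nonneg.2 (zero_le_one.trans S.lam_gt_one.le)
  rw [← ENNReal.ofReal_add hlam (sub_nonneg.2 hσ.le), add_sub_cancel] at h
  refine ⟨B, hB, fun f hf => iSup_le fun φ => ?_⟩
  obtain ⟨M, hM⟩ := φ.2.exists_bound_divg
  have hcont := continuous_divg φ.2.1
  set w : (Fin d → ℝ) → ℝ := S.Ω.indicator fun x => divg φ.1 (S.T x) with hw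
  have hmul : ∀ u : (Fin d → ℝ) → ℝ,
      ∫ x in S.Ω, u x * divg φ.1 (S.T x) = ∫ x, u x * w x := fun u => by
    rw [← integral_indicator hΩ]
    exact congrArg _ (funext fun x => indicator_mul_right S.Ω u _)
  have hwM : ∀ x, ‖w x‖ ≤ M := fun x => (norm_indicator_le_norm_self _ x).trans (hM _)
  have hfi : Integrable (S.Ω.indicator f) := (integrable_indicator_iff hΩ).2 hf
  have hfc : HasCompactSupport (S.Ω.indicator f) :=
    HasCompactSupport.intro isCompact_Icc fun x hx =>
      indicator_of_notMem (fun h => hx (S.Ω_subset h)) f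
  have key := ofReal_integral_mul_le_of_smooth
    ((aestronglyMeasurable_indicator_iff hΩ).2 (S.aestronglyMeasurable_comp_T hcont)) hwM
    (a := ENNReal.ofReal σ) (b := B) (fun u hu huc => by
      rw [← hmul]
      exact h φ.1 φ.2 u (hu.of_le (by norm_num)) huc) hfi hfc
  have hL1 : ∫⁻ x, ‖S.Ω.indicator f x‖ₑ = ∫⁻ x in S.Ω, ‖f x‖ₑ := by
    simp only [enorm_indicator_eq_indicator_enorm]
    exact lintegral_indicator hΩ _
  have hint : ∫ x, S.Ω.indicator f x * w x = ∫ x in S.Ω, f x * divg φ.1 (S.T x) := by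
    rw [hmul]
    refine integral_congr_ae (ae_of_all _ fun x => ?_)
    by_cases hx : x ∈ S.Ω <;> simp [hw, hx]
  rw [hL1, hint] at key
  rwa [S.integral_indicator_transferOp_mul hf hcont hM]

lemma integrableOn_iterate_transferOp {f : (Fin d → ℝ) → ℝ} (hf : IntegrableOn f S.Ω) (n : ℕ) :
    IntegrableOn ((transferOp S.Ω S.T)^[n] f) S.Ω ∧
      ∫⁻ x in S.Ω, ‖(transferOp S.Ω S.T)^[n] f x‖ₑ ≤ ∫⁻ x in S.Ω, ‖f x‖ₑ := by
  induction n with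
  | zero => exact ⟨hf, le_rfl⟩
  | succ n ih =>
    rw [Function.iterate_succ_apply']
    exact ⟨(S.integrable_transferOp ih.1).integrableOn,
      (setLIntegral_le_lintegral _ _).trans ((S.lintegral_transferOp_le ih.1).trans ih.2)⟩

end PES

theorem statement6 {d : ℕ} (hd : 1 ≤ d) (S : PES d) (σ : ℝ)
    (hσ : σ ∈ Set.Ioo S.lam⁻¹ 1) :
    ∃ B > (0:ℝ), ∀ n : ℕ, ∀ h : (Fin d → ℝ) → ℝ, MemBVOn S.Ω h →
      bvNormOnE S.Ω ((transferOp S.Ω S.T)^[n] h) ≤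
        ENNReal.ofReal (σ ^ n) * bvNormOnE S.Ω h +
          ENNReal.ofReal B * ∫⁻ x in S.Ω, ENNReal.ofReal |h x| ∂volume := by
  obtain ⟨A, hA, hstep⟩ := S.exists_bvNormOnE_transferOp_le hσ.1
  have hσ0 : 0 ≤ σ := (inv_nonneg.2 (zero_le_one.trans S.lam_gt_one.le)).trans hσ.1.le
  have hσ1 : 0 < 1 - σ := sub_pos.2 hσ.2
  have hA0 : 0 ≤ A.toReal := ENNReal.toReal_nonneg
  have hB : 0 < (A.toReal + 1) / (1 - σ) := by positivity
  have hrec : σ * ((A.toReal + 1) / (1 - σ)) + A.toReal ≤ (A.toReal + 1) / (1 - σ) := by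
    have h1 : (1 - σ) * ((A.toReal + 1) / (1 - σ)) = A.toReal + 1 :=
      mul_div_cancel₀ _ hσ1.ne'
    linarith
  set B := (A.toReal + 1) / (1 - σ)
  refine ⟨B, hB, fun n h hh => ?_⟩
  have hint : IntegrableOn h S.Ω := (integrable_indicator_iff S.Ω_open.measurableSet).1 hh.1
  simp only [← Real.enorm_eq_ofReal_abs]
  set I := ∫⁻ x in S.Ω, ‖h x‖ₑ
  induction n with
  | zero => simp
  | succ n ih =>
    have hn := S.integrableOn_iterate_transferOp hint n
    rw [Function.iterate_succ_apply']
    calc bvNormOnE S.Ω (transferOp S.Ω S.T ((transferOp S.Ω S.T)^[n] h))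
        ≤ ENNReal.ofReal σ * bvNormOnE S.Ω ((transferOp S.Ω S.T)^[n] h) +
          A * ∫⁻ x in S.Ω, ‖(transferOp S.Ω S.T)^[n] h x‖ₑ := hstep _ hn.1
      _ ≤ ENNReal.ofReal σ * (ENNReal.ofReal (σ ^ n) * bvNormOnE S.Ω h +
          ENNReal.ofReal B * I) + ENNReal.ofReal A.toReal * I := by
          rw [ENNReal.ofReal_toReal hA]
          exact add_le_add (mul_le_mul' le_rfl ih) (mul_le_mul' le_rfl hn.2)
      _ = ENNReal.ofReal (σ ^ (n + 1)) * bvNormOnE S.Ω h +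
          ENNReal.ofReal (σ * B + A.toReal) * I := by
          rw [ENNReal.ofReal_add (by positivity) hA0, ENNReal.ofReal_mul hσ0, pow_succ',
            ENNReal.ofReal_mul hσ0]
          ring
      _ ≤ ENNReal.ofReal (σ ^ (n + 1)) * bvNormOnE S.Ω h + ENNReal.ofReal B * I := by
          gcongr

end Liverani
end
end

section
/- Let d ≥ 1, let Ω ⊆ [0,1]^d be open, and assume there exist C > 0 and α ∈ (0,1] such that m({x ∈ Ω : dist(x, ∂Ω) < ε}) ≤ C^d ε^α for every ε > 0. Then there exists a constant C' > 0, depending only on η, d, C and α, such that for every h ∈ BV(Ω) with h ≥ 0 and ∫ h dm = 1 and every δ ∈ (0,1), ‖h − h_δ‖_{L¹(Ω,m)} ≤ C' δ^{α/d} ‖h‖_{BV(Ω)}. -/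
open MeasureTheory Set Filter Topology
open scoped ENNReal NNReal Classical

noncomputable section

namespace Liverani

/-- The `L¹` norm is recovered by testing against `C¹` compactly supported functions bounded
by `1`. -/
theorem integral_abs_le_of_forall_contDiff {d : ℕ} {g : (Fin d → ℝ) → ℝ} (hg : Integrable g)
    {B : ℝ} (H : ∀ ψ : (Fin d → ℝ) → ℝ, ContDiff ℝ 1 ψ → HasCompactSupport ψ →
      (∀ x, |ψ x| ≤ 1) → ∫ x, g x * ψ x ≤ B) :
    ∫ x, |g x| ≤ B := by
  wlog hm : StronglyMeasurable g generalizing g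
  · have hae := hg.1.ae_eq_mk
    have h1 : ∫ x, |g x| = ∫ x, |hg.1.mk g x| :=
      integral_congr_ae (by filter_upwards [hae] with x hx; rw [hx])
    rw [h1]
    refine this (hg.congr hae) (fun ψ h1 h2 h3 => ?_) hg.1.stronglyMeasurable_mk
    refine le_trans (le_of_eq (integral_congr_ae ?_)) (H ψ h1 h2 h3)
    filter_upwards [hae] with x hx
    rw [hx]
  refine le_of_forall_pos_le_add fun ε hε => ?_
  set ν : Measure (Fin d → ℝ) := volume.withDensity (fun x => ‖g x‖ₑ) with hν
  have : IsFiniteMeasure ν := isFiniteMeasure_withDensity hg.2.ne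
  have hνA : ∀ A : Set (Fin d → ℝ), MeasurableSet A → ∫ x in A, |g x| = ν.real A := by
    intro A hA
    simp_rw [← Real.norm_eq_abs]
    rw [integral_norm_eq_lintegral_enorm hg.1.restrict, Measure.real, hν, withDensity_apply _ hA]
  set P : Set (Fin d → ℝ) := {x | 0 < g x} with hP
  have hPm : MeasurableSet P := measurableSet_lt measurable_const hm.measurable
  have hε' : ENNReal.ofReal (ε / 4) ≠ 0 := by simp [hε]
  obtain ⟨K₁, hK₁P, hK₁, hK₁ν⟩ := hPm.exists_isCompact_sdiff_lt (measure_ne_top ν P) hε'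
  obtain ⟨K₂, hK₂P, hK₂, hK₂ν⟩ :=
    hPm.compl.exists_isCompact_sdiff_lt (measure_ne_top ν Pᶜ) hε'
  have hdisj : Disjoint K₂ K₁ := (disjoint_compl_left.mono hK₂P hK₁P)
  obtain ⟨u, hu0, hu1, hu⟩ := exists_contMDiffMap_zero_one_of_isClosed
    (n := 1) (modelWithCornersSelf ℝ (Fin d → ℝ)) hK₂.isClosed hK₁.isClosed hdisj
  obtain ⟨R, hR, hKR⟩ := (hK₁.union hK₂).isBounded.subset_closedBall_lt 0 (0 : Fin d → ℝ)
  let χ : ContDiffBump (0 : Fin d → ℝ) := ⟨R, R + 1, hR, by linarith⟩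
  have hχ1 : ∀ x ∈ K₁ ∪ K₂, χ x = 1 := fun x hx => χ.one_of_mem_closedBall (hKR hx)
  set ψ : (Fin d → ℝ) → ℝ := fun x => χ x * (2 * u x - 1) with hψ
  have hψ1 : ContDiff ℝ 1 ψ :=
    χ.contDiff.mul ((contDiff_const.mul u.contMDiff.contDiff).sub contDiff_const)
  have hψ2 : HasCompactSupport ψ := χ.hasCompactSupport.mul_right
  have hψ3 : ∀ x, |ψ x| ≤ 1 := by
    intro x
    have h1 := hu x
    rw [hψ]
    simp only [abs_mul, abs_of_nonneg χ.nonneg]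
    have h2 : |2 * u x - 1| ≤ 1 := abs_le.2 ⟨by linarith [h1.1], by linarith [h1.2]⟩
    exact mul_le_one₀ χ.le_one (abs_nonneg _) h2
  have hgψ : Integrable fun x => g x * ψ x :=
    hg.mul_bdd (c := 1) hψ1.continuous.aestronglyMeasurable (ae_of_all _ hψ3)
  have hD1 : MeasurableSet (P \ K₁) := hPm.diff hK₁.measurableSet
  have hD2 : MeasurableSet (Pᶜ \ K₂) := hPm.compl.diff hK₂.measurableSet
  have hpt : ∀ x, |g x| - g x * ψ x ≤ 2 * ((P \ K₁).indicator (fun x => |g x|) x +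
      (Pᶜ \ K₂).indicator (fun x => |g x|) x) := by
    intro x
    have hb : |g x| - g x * ψ x ≤ 2 * |g x| := by
      have h1 : |g x * ψ x| ≤ |g x| := by
        rw [abs_mul]; exact mul_le_of_le_one_right (abs_nonneg _) (hψ3 x)
      linarith [neg_abs_le (g x * ψ x)]
    by_cases hx : x ∈ P
    · have hx' : x ∉ Pᶜ \ K₂ := fun h => h.1 hx
      rw [indicator_of_notMem hx', add_zero]
      by_cases hxK : x ∈ K₁
      · have h1 : ψ x = 1 := by
          have := hu1 hxK
          simp only [Pi.one_apply] at this
          simp only [hψ, hχ1 x (Or.inl hxK), this]; norm_num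
        rw [indicator_of_notMem (fun h => h.2 hxK), h1, abs_of_pos hx]; simp
      · rw [indicator_of_mem (mem_sdiff_of_mem hx hxK)]; exact hb
    · have hx' : x ∉ P \ K₁ := fun h => hx h.1
      rw [indicator_of_notMem hx', zero_add]
      by_cases hxK : x ∈ K₂
      · have h1 : ψ x = -1 := by
          have := hu0 hxK
          simp only [Pi.zero_apply] at this
          simp only [hψ, hχ1 x (Or.inr hxK), this]; norm_num
        rw [indicator_of_notMem (fun h => h.2 hxK), h1, abs_of_nonpos (not_lt.1 hx)]; simp
      · rw [indicator_of_mem (mem_sdiff_of_mem hx hxK)]; exact hb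
  have hint := integral_mono (hg.abs.sub hgψ)
    (((hg.abs.indicator hD1).add (hg.abs.indicator hD2)).const_mul 2) hpt
  rw [integral_const_mul, integral_add' (hg.abs.indicator hD1) (hg.abs.indicator hD2),
    integral_indicator hD1, integral_indicator hD2] at hint
  simp only [Pi.sub_apply] at hint
  rw [integral_sub hg.abs hgψ, hνA _ hD1, hνA _ hD2] at hint
  have e1 : ν.real (P \ K₁) ≤ ε / 4 := ENNReal.toReal_le_of_le_ofReal (by positivity) hK₁ν.le
  have e2 : ν.real (Pᶜ \ K₂) ≤ ε / 4 := ENNReal.toReal_le_of_le_ofReal (by positivity) hK₂ν.le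
  linarith [H ψ hψ1 hψ2 hψ3]

/-- A vector field of sup norm at most `M` tests the BV seminorm up to the factor `M`. -/
theorem integral_mul_divg_le {d : ℕ} {f : (Fin d → ℝ) → ℝ} (hf : MemBV f)
    {φ : (Fin d → ℝ) → (Fin d → ℝ)} (hφ : ContDiff ℝ 1 φ) (hc : HasCompactSupport φ)
    {M : ℝ} (hM : 0 < M) (hb : ∀ x, ‖φ x‖ ≤ M) :
    ∫ x, f x * divg φ x ≤ M * bvNorm f := by
  have ht : IsTest d (fun x => M⁻¹ • φ x) := by
    refine ⟨hφ.const_smul M⁻¹, hc.smul_left (f := fun _ => M⁻¹), fun x => ?_⟩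
    rw [norm_smul, Real.norm_of_nonneg (by positivity), inv_mul_le_iff₀ hM, mul_one]
    exact hb x
  have hdiv : ∀ x, divg (fun x => M⁻¹ • φ x) x = M⁻¹ * divg φ x := by
    intro x
    have hd : DifferentiableAt ℝ φ x := hφ.differentiable one_ne_zero x
    simp only [divg, fderiv_fun_const_smul hd, Finset.mul_sum]
    rfl
  have h1 : ENNReal.ofReal (∫ x, f x * divg (fun x => M⁻¹ • φ x) x) ≤ bvNormE f :=
    le_iSup (fun φ : {φ : (Fin d → ℝ) → (Fin d → ℝ) // IsTest d φ} =>
      ENNReal.ofReal (∫ x, f x * divg φ.1 x)) ⟨_, ht⟩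
  have h2 := (ENNReal.ofReal_le_iff_le_toReal hf.2.ne).1 h1
  simp_rw [hdiv, mul_left_comm (f _), integral_const_mul] at h2
  rwa [inv_mul_le_iff₀ hM] at h2

theorem divg_smul_const {d : ℕ} {ψ : (Fin d → ℝ) → ℝ} {x : Fin d → ℝ}
    (hψ : DifferentiableAt ℝ ψ x) (z : Fin d → ℝ) :
    divg (fun y => ψ y • z) x = fderiv ℝ ψ x z := by
  have h := (fderiv ℝ ψ x).toLinearMap.pi_apply_eq_sum_univ z
  simp only [ContinuousLinearMap.coe_coe] at h
  rw [h, divg, fderiv_smul_const hψ]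
  refine Finset.sum_congr rfl fun j _ => ?_
  have : (Pi.single j 1 : Fin d → ℝ) = fun k => if j = k then 1 else 0 := by
    ext k; simp [Pi.single_apply, eq_comm]
  simp [this, mul_comm]

/-- The directional derivative of a test function bounded by `1` tests the BV seminorm. -/
theorem integral_mul_fderiv_le {d : ℕ} {f : (Fin d → ℝ) → ℝ} (hf : MemBV f)
    {ψ : (Fin d → ℝ) → ℝ} (hψ : ContDiff ℝ 1 ψ) (hc : HasCompactSupport ψ)
    (z : Fin d → ℝ) {M : ℝ} (hM : 0 < M) (hb : ∀ x, |ψ x| * ‖z‖ ≤ M) :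
    ∫ x, f x * fderiv ℝ ψ x z ≤ M * bvNorm f := by
  have h := integral_mul_divg_le hf (φ := fun y => ψ y • z) (hψ.smul contDiff_const)
    hc.smul_right hM (fun x => by rw [norm_smul]; exact hb x)
  simpa only [divg_smul_const (hψ.differentiable one_ne_zero _)] using h

theorem integral_mul_comp_add_sub_le {d : ℕ} {f : (Fin d → ℝ) → ℝ} (hf : MemBV f)
    {ψ : (Fin d → ℝ) → ℝ} (hψ : ContDiff ℝ 1 ψ) (hc : HasCompactSupport ψ)
    (h1 : ∀ x, |ψ x| ≤ 1) {z : Fin d → ℝ} {δ : ℝ} (hδ : 0 < δ) (hz : ‖z‖ ≤ δ) :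
    ∫ x, f x * (ψ x - ψ (x + z)) ≤ δ * bvNorm f := by
  have hfi := hf.1
  obtain ⟨A, hA⟩ := (hψ.continuous_fderiv one_ne_zero).bounded_above_of_compact_support
    (hc.fderiv ℝ)
  have hshift : ∀ s : ℝ, ContDiff ℝ 1 (fun x => ψ (x + s • z)) := fun s =>
    hψ.comp (contDiff_id.add contDiff_const)
  have hshiftc : ∀ s : ℝ, HasCompactSupport (fun x => ψ (x + s • z)) := fun s =>
    hc.comp_homeomorph (Homeomorph.addRight (s • z))
  have hfd : ∀ (s : ℝ) x, fderiv ℝ (fun x => ψ (x + s • z)) x = fderiv ℝ ψ (x + s • z) :=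
    fun s x => fderiv_comp_add_right _
  have hint : ∀ s : ℝ, Integrable fun x => f x * ψ (x + s • z) := fun s =>
    hfi.mul_bdd (c := 1) (hshift s).continuous.aestronglyMeasurable (ae_of_all _ fun x => h1 _)
  have hcont : Continuous fun x => fderiv ℝ ψ x z :=
    (hψ.continuous_fderiv one_ne_zero).clm_apply continuous_const
  have hderiv : ∀ s : ℝ, HasDerivAt (fun s => ∫ x, f x * ψ (x + s • z))
      (∫ x, f x * fderiv ℝ ψ (x + s • z) z) s := by
    intro s
    refine (hasDerivAt_integral_of_dominated_loc_of_deriv_le (μ := volume) (s := univ)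
      (F := fun s x => f x * ψ (x + s • z)) (F' := fun s x => f x * fderiv ℝ ψ (x + s • z) z)
      (bound := fun x => |f x| * (A * ‖z‖)) univ_mem
      (Eventually.of_forall fun s => (hint s).1) (hint s) ?_ ?_ ?_ ?_).2
    · exact hfi.1.mul
        (hcont.comp (continuous_id.add continuous_const)).aestronglyMeasurable
    · refine ae_of_all _ fun x s _ => ?_
      rw [norm_mul, Real.norm_eq_abs]
      gcongr
      exact (ContinuousLinearMap.le_opNorm _ _).trans (by gcongr; exact hA _)
    · exact hfi.abs.mul_const _
    · refine ae_of_all _ fun x s _ => ?_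
      have h2 : HasDerivAt (fun s : ℝ => x + s • z) z s := by
        simpa using ((hasDerivAt_id s).smul_const z).const_add x
      exact ((hψ.differentiable one_ne_zero _).hasFDerivAt.comp_hasDerivAt s h2).const_mul (f x)
  have hbd : ∀ s ∈ Ico (0 : ℝ) 1,
      ‖∫ x, f x * fderiv ℝ ψ (x + s • z) z‖ ≤ δ * bvNorm f := by
    intro s _
    have hs1 : ∀ x, |ψ (x + s • z)| * ‖z‖ ≤ δ := fun x =>
      (mul_le_of_le_one_left (norm_nonneg z) (h1 _)).trans hz
    have u1 := integral_mul_fderiv_le hf (hshift s) (hshiftc s) z hδ hs1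
    have u2 := integral_mul_fderiv_le hf (hshift s) (hshiftc s) (-z) hδ (by simpa using hs1)
    simp only [hfd, map_neg, mul_neg, integral_neg] at u1 u2
    exact abs_le.2 ⟨by linarith, u1⟩
  have hmv := norm_image_sub_le_of_norm_deriv_le_segment_01'
    (fun s _ => (hderiv s).hasDerivWithinAt) hbd
  simp only [one_smul, zero_smul, add_zero] at hmv
  have h0 : Integrable fun x => f x * ψ x := by simpa using hint 0
  have h1' : Integrable fun x => f x * ψ (x + z) := by simpa using hint 1
  simp_rw [mul_sub]
  rw [integral_sub h0 h1']
  rw [Real.norm_eq_abs, abs_sub_comm] at hmv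
  exact (le_abs_self _).trans hmv

/-- Translations are Lipschitz in `L¹` on functions of bounded variation. -/
theorem integral_abs_sub_translate_le {d : ℕ} {f : (Fin d → ℝ) → ℝ} (hf : MemBV f)
    {z : Fin d → ℝ} {δ : ℝ} (hδ : 0 < δ) (hz : ‖z‖ ≤ δ) :
    ∫ x, |f x - f (x - z)| ≤ δ * bvNorm f := by
  have hfi := hf.1
  have hfz : Integrable fun x => f (x - z) := hfi.comp_sub_right z
  refine integral_abs_le_of_forall_contDiff (hfi.sub hfz) fun ψ h1 h2 h3 => ?_
  refine le_trans (le_of_eq ?_) (integral_mul_comp_add_sub_le hf h1 h2 h3 hδ hz)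
  have i1 : Integrable fun x => f x * ψ x :=
    hfi.mul_bdd (c := 1) h1.continuous.aestronglyMeasurable (ae_of_all _ h3)
  have i2 : Integrable fun x => f (x - z) * ψ x :=
    hfz.mul_bdd (c := 1) h1.continuous.aestronglyMeasurable (ae_of_all _ h3)
  have i3 : Integrable fun x => f x * ψ (x + z) := by
    simpa using i2.comp_add_right z
  simp only [Pi.sub_apply, sub_mul, mul_sub]
  rw [integral_sub i1 i2, integral_sub i1 i3,
    ← integral_add_right_eq_self (fun x => f (x - z) * ψ x) z]
  simp

/-- The BV seminorm of a function supported in the unit cube controls its integral. -/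
theorem integral_le_three_mul_bvNorm {d : ℕ} (hd : 1 ≤ d) {f : (Fin d → ℝ) → ℝ} (hf : MemBV f)
    (hs : ∀ x, x ∉ Icc (0 : Fin d → ℝ) 1 → f x = 0) :
    ∫ x, f x ≤ 3 * bvNorm f := by
  let χ : ContDiffBump (0 : Fin d → ℝ) := ⟨2, 3, by norm_num, by norm_num⟩
  let i : Fin d := ⟨0, hd⟩
  have hψ : ContDiff ℝ 1 fun x => χ x * x i := χ.contDiff.mul (contDiff_apply ℝ ℝ i)
  have hc : HasCompactSupport fun x => χ x * x i := χ.hasCompactSupport.mul_right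
  have hb : ∀ x : Fin d → ℝ, |χ x * x i| * ‖(Pi.single i 1 : Fin d → ℝ)‖ ≤ 3 := by
    intro x
    rw [Pi.norm_single, norm_one, mul_one, abs_mul, abs_of_nonneg χ.nonneg]
    by_cases hx : ‖x‖ < 3
    · have h1 : |x i| ≤ 3 := (norm_le_pi_norm x i).trans hx.le
      nlinarith [χ.le_one (x := x), χ.nonneg (x := x), abs_nonneg (x i)]
    · rw [χ.zero_of_le_dist (by simpa using hx)]; simp
  refine le_trans (le_of_eq (integral_congr_ae (ae_of_all _ fun x => ?_)))
    (integral_mul_fderiv_le hf hψ hc (Pi.single i 1) (by norm_num) hb)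
  by_cases hx : x ∈ Icc (0 : Fin d → ℝ) 1
  · have hx2 : x ∈ Metric.ball (0 : Fin d → ℝ) 2 := by
      rw [mem_ball_zero_iff]
      refine lt_of_le_of_lt ((pi_norm_le_iff_of_nonneg zero_le_one).2 fun j => ?_) one_lt_two
      rw [Real.norm_eq_abs]
      exact abs_le.2 ⟨by linarith [hx.1 j, show (0 : Fin d → ℝ) j = 0 from rfl], hx.2 j⟩
    have he : (fun x => χ x * x i) =ᶠ[𝓝 x] fun x => x i := by
      filter_upwards [χ.eventuallyEq_one_of_mem_ball hx2] with y hy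
      simp [hy]
    simp [he.fderiv_eq, (hasFDerivAt_apply i x).fderiv]
  · simp [hs x hx]

theorem moll_nonneg {d : ℕ} {η : ℝ → ℝ} (hη : IsMollifier η) {δ : ℝ} (hδ : 0 < δ)
    (x : Fin d → ℝ) : 0 ≤ moll d η δ x :=
  mul_nonneg (by positivity) (Finset.prod_nonneg fun _ _ => hη.2.1 _)

theorem norm_le_of_moll_ne_zero {d : ℕ} {η : ℝ → ℝ} (hη : IsMollifier η) {δ : ℝ} (hδ : 0 < δ)
    {x : Fin d → ℝ} (hx : moll d η δ x ≠ 0) : ‖x‖ ≤ δ := by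
  refine (pi_norm_le_iff_of_nonneg hδ.le).2 fun i => ?_
  have h1 : η (δ⁻¹ * x i) ≠ 0 := fun h0 =>
    hx (by rw [moll, Finset.prod_eq_zero (Finset.mem_univ i) h0, mul_zero])
  have h2 : |δ⁻¹ * x i| ≤ 1 := abs_le.2 (hη.2.2.1 h1)
  rwa [abs_mul, abs_of_pos (inv_pos.2 hδ), inv_mul_le_iff₀ hδ, mul_one] at h2

theorem continuous_moll {d : ℕ} {η : ℝ → ℝ} (hη : IsMollifier η) (δ : ℝ) :
    Continuous (moll d η δ) := by
  have := hη.1.continuous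
  unfold moll
  fun_prop

theorem hasCompactSupport_moll {d : ℕ} {η : ℝ → ℝ} (hη : IsMollifier η) {δ : ℝ} (hδ : 0 < δ) :
    HasCompactSupport (moll d η δ) := by
  refine HasCompactSupport.intro (isCompact_closedBall (0 : Fin d → ℝ) δ) fun x hx => ?_
  by_contra h
  exact hx (mem_closedBall_zero_iff.2 (norm_le_of_moll_ne_zero hη hδ h))

theorem integral_moll {d : ℕ} {η : ℝ → ℝ} (hη : IsMollifier η) {δ : ℝ} (hδ : 0 < δ) :
    ∫ x, moll d η δ x = 1 := by
  simp only [moll]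
  rw [integral_const_mul, integral_fintype_prod_volume_eq_pow (fun y => η (δ⁻¹ * y)),
    Measure.integral_comp_mul_left, hη.2.2.2, inv_inv, abs_of_pos hδ, Fintype.card_fin]
  simp [hδ.ne']

/-- The `L¹` distance between a BV function and its mollification. -/
theorem integral_abs_sub_moll_le {d : ℕ} {η : ℝ → ℝ} (hη : IsMollifier η) {δ : ℝ} (hδ : 0 < δ)
    {f : (Fin d → ℝ) → ℝ} (hf : MemBV f) :
    Integrable (fun x => f x - ∫ y, moll d η δ (x - y) * f y) ∧
      ∫ x, |f x - ∫ y, moll d η δ (x - y) * f y| ≤ δ * bvNorm f := by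
  have hfi := hf.1
  have hmi : Integrable (moll d η δ) :=
    (continuous_moll hη δ).integrable_of_hasCompactSupport (hasCompactSupport_moll hη hδ)
  obtain ⟨A, hA⟩ := (continuous_moll (d := d) hη δ).bounded_above_of_compact_support
    (hasCompactSupport_moll hη hδ)
  have hconv := hmi.convolution_integrand (ContinuousLinearMap.mul ℝ ℝ) hfi
  simp only [ContinuousLinearMap.mul_apply'] at hconv
  have hF : Integrable (fun p : (Fin d → ℝ) × (Fin d → ℝ) =>
      moll d η δ p.2 * (f p.1 - f (p.1 - p.2))) (volume.prod volume) := by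
    refine ((hfi.mul_prod hmi).sub hconv).congr (ae_of_all _ fun p => ?_)
    simp only [Pi.sub_apply]
    ring
  have hrepr : ∀ x, f x - ∫ y, moll d η δ (x - y) * f y =
      ∫ z, moll d η δ z * (f x - f (x - z)) := by
    intro x
    have i1 : Integrable fun z => moll d η δ z * f (x - z) :=
      (hfi.comp_sub_left x).bdd_mul (continuous_moll hη δ).aestronglyMeasurable
        (ae_of_all _ hA)
    simp_rw [mul_sub]
    rw [integral_sub (hmi.mul_const _) i1, integral_mul_const, integral_moll hη hδ, one_mul,
      ← integral_sub_left_eq_self (fun y => moll d η δ (x - y) * f y) volume x]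
    simp
  simp_rw [hrepr]
  refine ⟨hF.integral_prod_left, ?_⟩
  calc ∫ x, |∫ z, moll d η δ z * (f x - f (x - z))|
      ≤ ∫ x, ∫ z, |moll d η δ z * (f x - f (x - z))| :=
        integral_mono hF.integral_prod_left.abs hF.abs.integral_prod_left
          fun x => abs_integral_le_integral_abs
    _ = ∫ z, ∫ x, |moll d η δ z * (f x - f (x - z))| := integral_integral_swap hF.abs
    _ ≤ ∫ z, moll d η δ z * (δ * bvNorm f) := by
        refine integral_mono hF.abs.integral_prod_right (hmi.mul_const _) fun z => ?_
        simp only [abs_mul, abs_of_nonneg (moll_nonneg hη hδ z)]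
        rw [integral_const_mul]
        by_cases hz : moll d η δ z = 0
        · simp [hz]
        · exact mul_le_mul_of_nonneg_left
            (integral_abs_sub_translate_le hf hδ (norm_le_of_moll_ne_zero hη hδ hz))
            (moll_nonneg hη hδ z)
    _ = δ * bvNorm f := by rw [integral_mul_const, integral_moll hη hδ, one_mul]

theorem statement12 {d : ℕ} (hd : 1 ≤ d) (η : ℝ → ℝ) (hη : IsMollifier η)
    (C α : ℝ) (hC : 0 < C) (hα : α ∈ Set.Ioc (0:ℝ) 1) :
    ∃ C' > (0:ℝ), ∀ Ω : Set (Fin d → ℝ), IsOpen Ω → Ω ⊆ Set.Icc 0 1 →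
      (∀ ε : ℝ, 0 < ε →
        volume {x ∈ Ω | Metric.infDist x (frontier Ω) < ε} ≤
          ENNReal.ofReal (C ^ d * ε ^ α)) →
      ∀ h : (Fin d → ℝ) → ℝ, MemBVOn Ω h → (∀ x, 0 ≤ h x) →
        (∫ x in Ω, h x = 1) → ∀ δ ∈ Set.Ioo (0:ℝ) 1,
        ∫ x in Ω, |h x - mollify d η Ω h δ x| ≤
          C' * δ ^ (α / (d:ℝ)) * bvNormOn Ω h := by
  refine ⟨4, by norm_num, fun Ω hΩ hΩs _ h hh _ h1 δ hδ => ?_⟩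
  have hΩm := hΩ.measurableSet
  have hvol : volume Ω ≤ 1 := (measure_mono hΩs).trans (by simp [Real.volume_Icc_pi])
  set f := Ω.indicator h with hf
  have hlow : 1 ≤ 3 * bvNorm f := by
    rw [← h1, ← integral_indicator hΩm]
    exact integral_le_three_mul_bvNorm hd hh fun x hx =>
      indicator_of_notMem (fun hxΩ => hx (hΩs hxΩ)) h
  obtain ⟨hi, hle⟩ := integral_abs_sub_moll_le hη hδ.1 hh
  have hmol : ∀ x ∈ Ω, |h x - mollify d η Ω h δ x| ≤
      |f x - ∫ y, moll d η δ (x - y) * f y| + δ := by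
    intro x hx
    have e : ∫ y in Ω, moll d η δ (x - y) * h y = ∫ y, moll d η δ (x - y) * f y := by
      rw [← integral_indicator hΩm]
      refine integral_congr_ae (ae_of_all _ fun y => ?_)
      by_cases hy : y ∈ Ω <;> simp [hf, hy]
    rw [mollify, e, hf, indicator_of_mem hx, ← sub_sub]
    exact (abs_sub _ _).trans_eq (by rw [abs_of_pos hδ.1])
  have hfin : IsFiniteMeasure (volume.restrict Ω) :=
    ⟨by rw [Measure.restrict_apply_univ]; exact hvol.trans_lt ENNReal.one_lt_top⟩
  have hvol' : volume.real Ω ≤ 1 := ENNReal.toReal_le_of_le_ofReal zero_le_one (by simpa)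
  have hpow : δ ≤ δ ^ (α / (d : ℝ)) := by
    have hd' : (1 : ℝ) ≤ d := by exact_mod_cast hd
    refine (Real.rpow_one δ).symm.le.trans
      (Real.rpow_le_rpow_of_exponent_ge hδ.1 hδ.2.le ?_)
    exact div_le_one_of_le₀ (hα.2.trans hd') (by positivity)
  have hN : 0 ≤ bvNorm f := ENNReal.toReal_nonneg
  calc ∫ x in Ω, |h x - mollify d η Ω h δ x|
      ≤ ∫ x in Ω, (|f x - ∫ y, moll d η δ (x - y) * f y| + δ) := by
        refine integral_mono_of_nonneg (ae_of_all _ fun x => abs_nonneg _)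
          (hi.abs.restrict.add (integrable_const δ)) ?_
        filter_upwards [ae_restrict_mem hΩm] with x hx using hmol x hx
    _ = (∫ x in Ω, |f x - ∫ y, moll d η δ (x - y) * f y|) + volume.real Ω * δ := by
        rw [integral_add hi.abs.restrict (integrable_const δ), setIntegral_const, smul_eq_mul]
    _ ≤ δ * bvNorm f + 1 * δ := by
        have := hδ.1.le
        gcongr
        exact (setIntegral_le_integral hi.abs (ae_of_all _ fun x => abs_nonneg _)).trans hle
    _ ≤ 4 * δ * bvNorm f := by nlinarith [hδ.1]
    _ ≤ 4 * δ ^ (α / (d : ℝ)) * bvNormOn Ω h := by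
        rw [bvNormOn]; gcongr

end Liverani
end
end

section
/- Let d ≥ 2 and Ω ⊆ [0,1]^d. There exists a constant C_d > 0, depending only on d, such that for every h ∈ BV(Ω) with h ≥ 0 and ∫ h dm = 1, the set A := {x ∈ Ω : h(x) ≥ 1/2} satisfies m(A) ≥ (2 C_d ‖h‖_{BV(Ω)})^{-d}. -/
open MeasureTheory Set Filter Topology
open scoped ENNReal NNReal Classical

noncomputable section

namespace Liverani

open scoped Convolution ContDiff

/-- Averaging against an even kernel is self-adjoint. -/
lemma integral_convolution_mul_of_even {G : Type*} [AddCommGroup G] [MeasurableSpace G]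
    [MeasurableAdd₂ G] [MeasurableNeg G] {μ : Measure G} [SFinite μ] [μ.IsAddLeftInvariant]
    [μ.IsNegInvariant] {ρ H f : G → ℝ} (hρ : Integrable ρ μ)
    (hρ_even : ∀ x, ρ (-x) = ρ x) (hH : Integrable H μ) (hf : AEStronglyMeasurable f μ)
    {c : ℝ} (hfc : ∀ x, ‖f x‖ ≤ c) :
    ∫ x, (ρ ⋆[ContinuousLinearMap.lsmul ℝ ℝ, μ] H) x * f x ∂μ =
      ∫ x, H x * (ρ ⋆[ContinuousLinearMap.lsmul ℝ ℝ, μ] f) x ∂μ := by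
  have h_int : Integrable (Function.uncurry fun x t => ρ (x - t) * H t * f x) (μ.prod μ) := by
    have h1 := (hH.convolution_integrand (ContinuousLinearMap.mul ℝ ℝ) hρ).mul_bdd
      (hf.comp_fst (ν := μ)) (Eventually.of_forall fun p : G × G => hfc p.1)
    refine h1.congr (Eventually.of_forall fun p => ?_)
    simp [Function.uncurry, mul_comm]
  calc ∫ x, (ρ ⋆[ContinuousLinearMap.lsmul ℝ ℝ, μ] H) x * f x ∂μ
      = ∫ x, ∫ t, ρ (x - t) * H t * f x ∂μ ∂μ := by
        refine integral_congr_ae (Eventually.of_forall fun x => ?_)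
        simp only [convolution_eq_swap, ContinuousLinearMap.lsmul_apply, smul_eq_mul]
        rw [← integral_mul_const]
    _ = ∫ t, ∫ x, ρ (x - t) * H t * f x ∂μ ∂μ := integral_integral_swap h_int
    _ = ∫ t, H t * (ρ ⋆[ContinuousLinearMap.lsmul ℝ ℝ, μ] f) t ∂μ := by
        refine integral_congr_ae (Eventually.of_forall fun t => ?_)
        simp only [convolution_eq_swap, ContinuousLinearMap.lsmul_apply, smul_eq_mul]
        rw [← integral_const_mul]
        refine integral_congr_ae (Eventually.of_forall fun x => ?_)
        dsimp only
        rw [← hρ_even (x - t), neg_sub]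
        ring

lemma integral_mul_divg_le_bvNorm {d : ℕ} {H : (Fin d → ℝ) → ℝ} (hH : bvNormE H < ⊤)
    {φ : (Fin d → ℝ) → (Fin d → ℝ)} (hφ : IsTest d φ) :
    ∫ x, H x * divg φ x ≤ bvNorm H := by
  rw [bvNorm, ← ENNReal.ofReal_le_iff_le_toReal hH.ne]
  exact le_iSup (fun φ : {φ : (Fin d → ℝ) → (Fin d → ℝ) // IsTest d φ} =>
    ENNReal.ofReal (∫ x, H x * divg φ.1 x)) ⟨φ, hφ⟩

lemma integral_mul_fderiv_single_le_bvNorm {d : ℕ} {H : (Fin d → ℝ) → ℝ}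
    (hH : bvNormE H < ⊤) {w : (Fin d → ℝ) → ℝ} (hw : ContDiff ℝ 1 w)
    (hwc : HasCompactSupport w) (hw1 : ∀ x, |w x| ≤ 1) (i : Fin d) :
    ∫ x, H x * fderiv ℝ w x (Pi.single i 1) ≤ bvNorm H := by
  have h_test : IsTest d fun x => w x • (Pi.single i 1 : Fin d → ℝ) := by
    refine ⟨hw.smul contDiff_const, hwc.smul_right, fun x => ?_⟩
    rw [norm_smul, Pi.norm_single]
    simpa using hw1 x
  have h_div : ∀ x, divg (fun x => w x • (Pi.single i 1 : Fin d → ℝ)) x =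
      fderiv ℝ w x (Pi.single i 1) := by
    intro x
    have := ((hw.differentiable one_ne_zero x).hasFDerivAt.smul_const
      (Pi.single i 1 : Fin d → ℝ)).fderiv
    simp [divg, this, Pi.single_apply]
  simpa only [h_div] using integral_mul_divg_le_bvNorm hH h_test

/-- The partial derivatives of a mollification of a `BV` function, tested against a field. -/
lemma integral_fderiv_convolution_mul_le_bvNorm {d : ℕ} {H : (Fin d → ℝ) → ℝ}
    (hH : MemBV H) (hHc : HasCompactSupport H)
    (b : ContDiffBump (0 : Fin d → ℝ)) {ψ : (Fin d → ℝ) → ℝ} (hψ : ContDiff ℝ 1 ψ)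
    (hψc : HasCompactSupport ψ) (hψ1 : ∀ x, |ψ x| ≤ 1) (i : Fin d) :
    ∫ x, fderiv ℝ (b.normed volume ⋆[ContinuousLinearMap.lsmul ℝ ℝ, volume] H) x
      (Pi.single i 1) * ψ x ≤ bvNorm H := by
  set ρ := b.normed (volume : Measure (Fin d → ℝ)) with hρ_def
  set L := ContinuousLinearMap.lsmul ℝ ℝ (E := ℝ) with hL
  have hρ : Integrable ρ := b.integrable_normed
  have hρc : HasCompactSupport ρ := b.hasCompactSupport_normed
  have hρ1 : ContDiff ℝ 1 ρ := b.contDiff_normed (n := 1)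
  set u := ρ ⋆[L, volume] H with hu_def
  have hu : ContDiff ℝ 1 u :=
    hρc.contDiff_convolution_left (n := 1) L hρ1 hH.1.locallyIntegrable
  have huc : HasCompactSupport u := HasCompactSupport.convolution L hρc hHc
  have hdψ : Continuous fun x => fderiv ℝ ψ x (Pi.single i 1) :=
    (hψ.continuous_fderiv one_ne_zero).clm_apply continuous_const
  have hdψc : HasCompactSupport fun x => fderiv ℝ ψ x (Pi.single i 1) :=
    hψc.fderiv_apply ℝ _
  have hdu : Continuous fun x => fderiv ℝ u x (Pi.single i 1) :=
    (hu.continuous_fderiv one_ne_zero).clm_apply continuous_const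
  have h_parts := integral_mul_fderiv_eq_neg_fderiv_mul_of_integrable
    (μ := (volume : Measure (Fin d → ℝ))) (f := u) (g := ψ) (v := Pi.single i 1)
    ((hdu.mul hψ.continuous).integrable_of_hasCompactSupport hψc.mul_left)
    ((hu.continuous.mul hdψ).integrable_of_hasCompactSupport huc.mul_right)
    ((hu.continuous.mul hψ.continuous).integrable_of_hasCompactSupport huc.mul_right)
    (fun x _ => hu.differentiable one_ne_zero x) (fun x _ => hψ.differentiable one_ne_zero x)
  obtain ⟨c, hc⟩ := hdψ.bounded_above_of_compact_support hdψc
  have h_adj := integral_convolution_mul_of_even hρ b.normed_neg hH.1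
    hdψ.aestronglyMeasurable hc
  set w := ρ ⋆[L, volume] ψ with hw_def
  have hw : ContDiff ℝ 1 w := hψc.contDiff_convolution_right (n := 1) L hρ.locallyIntegrable hψ
  have hwc : HasCompactSupport w := HasCompactSupport.convolution L hρc hψc
  have hw1 : ∀ x, |w x| ≤ 1 := by
    intro x
    calc |w x| ≤ ∫ t, ρ t := by
          rw [hw_def, convolution_def, ← Real.norm_eq_abs]
          refine norm_integral_le_of_norm_le hρ (Eventually.of_forall fun t => ?_)
          rw [hL, ContinuousLinearMap.lsmul_apply, smul_eq_mul, norm_mul,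
            Real.norm_of_nonneg (b.nonneg_normed t)]
          exact mul_le_of_le_one_right (b.nonneg_normed t) (hψ1 _)
      _ = 1 := b.integral_normed
  have hdw : ∀ x, fderiv ℝ w x (Pi.single i 1) =
      (ρ ⋆[L, volume] fun x => fderiv ℝ ψ x (Pi.single i 1)) x := by
    intro x
    rw [(hψc.hasFDerivAt_convolution_right L hρ.locallyIntegrable hψ x).fderiv]
    exact convolution_precompR_apply L hρ.locallyIntegrable (hψc.fderiv ℝ)
      (hψ.continuous_fderiv one_ne_zero) x _
  have h_neg := integral_mul_fderiv_single_le_bvNorm hH.2 hw.neg hwc.neg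
    (fun x => by simpa using hw1 x) i
  calc ∫ x, fderiv ℝ u x (Pi.single i 1) * ψ x
      = -∫ x, H x * fderiv ℝ w x (Pi.single i 1) := by
        simp only [hdw]
        rw [← h_adj, h_parts, neg_neg]
    _ = ∫ x, H x * fderiv ℝ (-w) x (Pi.single i 1) := by
        rw [← integral_neg]
        refine integral_congr_ae (Eventually.of_forall fun x => ?_)
        simp [fderiv_neg]
    _ ≤ bvNorm H := h_neg

/-- The `L¹` norm of a `C¹` function is controlled by its pairings with `C¹` test functions. -/
lemma integral_abs_le_of_forall_test {E : Type*} [NormedAddCommGroup E] [NormedSpace ℝ E]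
    [MeasurableSpace E] [BorelSpace E] {μ : Measure E}
    [IsFiniteMeasureOnCompacts μ] {g : E → ℝ} (hg : ContDiff ℝ 1 g) (hgc : HasCompactSupport g)
    {V : ℝ} (hV : ∀ ψ : E → ℝ, ContDiff ℝ 1 ψ → HasCompactSupport ψ → (∀ x, |ψ x| ≤ 1) →
      ∫ x, g x * ψ x ∂μ ≤ V) :
    ∫ x, |g x| ∂μ ≤ V := by
  have hg_int : Integrable g μ := hg.continuous.integrable_of_hasCompactSupport hgc
  set K := tsupport g with hK
  have hKm : MeasurableSet K := (isClosed_tsupport g).measurableSet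
  have hK_fin : μ K < ⊤ := IsCompact.measure_lt_top hgc
  have key : ∀ ε > 0, ∫ x, |g x| ∂μ ≤ V + ε * μ.real K := by
    intro ε hε
    have h_pos : ∀ x, 0 < g x ^ 2 + ε ^ 2 := fun x => by positivity
    set s : E → ℝ := fun x => √(g x ^ 2 + ε ^ 2) with hs_def
    have hs_pos : ∀ x, 0 < s x := fun x => Real.sqrt_pos.2 (h_pos x)
    have hs_sq : ∀ x, s x ^ 2 = g x ^ 2 + ε ^ 2 := fun x => Real.sq_sqrt (h_pos x).le
    have hs : ContDiff ℝ 1 s := ((hg.pow 2).add contDiff_const).sqrt fun x => (h_pos x).ne'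
    have hgs : ∀ x, |g x| ≤ s x := fun x =>
      abs_le_of_sq_le_sq (by nlinarith [hs_sq x, sq_nonneg ε]) (hs_pos x).le
    have hψ : ContDiff ℝ 1 fun x => g x * (s x)⁻¹ := hg.mul (hs.inv fun x => (hs_pos x).ne')
    have hψc : HasCompactSupport fun x => g x * (s x)⁻¹ := hgc.mul_right
    have hψ1 : ∀ x, |g x * (s x)⁻¹| ≤ 1 := fun x => by
      rw [abs_mul, abs_inv, abs_of_pos (hs_pos x), ← div_eq_mul_inv, div_le_one (hs_pos x)]
      exact hgs x
    have h_le : ∀ x, |g x| ≤ g x * (g x * (s x)⁻¹) + K.indicator (fun _ => ε) x := by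
      intro x
      by_cases hx : x ∈ K
      · rw [indicator_of_mem hx]
        have hsε : s x ≤ |g x| + ε := by
          refine le_of_sq_le_sq ?_ (by positivity)
          rw [hs_sq]
          nlinarith [sq_abs (g x), abs_nonneg (g x)]
        have : g x * (g x * (s x)⁻¹) = |g x| ^ 2 / s x := by
          rw [sq_abs]; field_simp
        rw [this, ← sub_le_iff_le_add, le_div_iff₀ (hs_pos x)]
        nlinarith [hgs x, abs_nonneg (g x), hs_sq x, sq_abs (g x), hs_pos x]
      · have : g x = 0 := image_eq_zero_of_notMem_tsupport hx
        simp [this, hx]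
    have h_int1 : Integrable (fun x => g x * (g x * (s x)⁻¹)) μ :=
      (hg.continuous.mul hψ.continuous).integrable_of_hasCompactSupport hgc.mul_right
    have h_int2 : Integrable (K.indicator fun _ => ε) μ :=
      (integrable_indicator_iff hKm).2 (integrableOn_const hK_fin.ne)
    calc ∫ x, |g x| ∂μ ≤ ∫ x, (g x * (g x * (s x)⁻¹) + K.indicator (fun _ => ε) x) ∂μ :=
          integral_mono hg_int.abs (h_int1.add h_int2) h_le
      _ = (∫ x, g x * (g x * (s x)⁻¹) ∂μ) + ε * μ.real K := by
          rw [integral_add h_int1 h_int2, integral_indicator hKm, setIntegral_const, smul_eq_mul,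
            mul_comm ε]
      _ ≤ V + ε * μ.real K := by gcongr; exact hV _ hψ hψc hψ1
  have h_lim : Tendsto (fun ε : ℝ => V + ε * μ.real K) (𝓝[>] 0) (𝓝 (V + 0 * μ.real K)) :=
    ((continuous_const.add (continuous_id.mul continuous_const)).tendsto 0).mono_left
      nhdsWithin_le_nhds
  simpa using ge_of_tendsto h_lim (eventually_mem_nhdsWithin.mono fun ε hε => key ε hε)

lemma norm_clm_pi_le_sum {d : ℕ} (A : (Fin d → ℝ) →L[ℝ] ℝ) :
    ‖A‖ ≤ ∑ i, |A (Pi.single i 1)| := by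
  refine A.opNorm_le_bound (Finset.sum_nonneg fun i _ => abs_nonneg _) fun x => ?_
  conv_lhs => rw [pi_eq_sum_univ' x, map_sum]
  rw [Finset.sum_mul]
  refine (norm_sum_le _ _).trans (Finset.sum_le_sum fun i _ => ?_)
  rw [map_smul, smul_eq_mul, norm_mul, mul_comm, Real.norm_eq_abs (A _)]
  gcongr
  exact norm_le_pi_norm x i

/-- The gradient of a mollification of a `BV` function is bounded in `L¹`. -/
lemma eLpNorm_fderiv_convolution_le {d : ℕ} {H : (Fin d → ℝ) → ℝ} (hH : MemBV H)
    (hHc : HasCompactSupport H) (b : ContDiffBump (0 : Fin d → ℝ)) :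
    eLpNorm (fderiv ℝ (b.normed volume ⋆[ContinuousLinearMap.lsmul ℝ ℝ, volume] H)) 1 volume ≤
      d * ENNReal.ofReal (bvNorm H) := by
  set u := b.normed volume ⋆[ContinuousLinearMap.lsmul ℝ ℝ, volume] H with hu_def
  have hu : ContDiff ℝ 2 u := b.hasCompactSupport_normed.contDiff_convolution_left (n := 2) _
    (b.contDiff_normed (n := 2)) hH.1.locallyIntegrable
  have huc : HasCompactSupport u :=
    HasCompactSupport.convolution _ b.hasCompactSupport_normed hHc
  have hdu : ∀ i, ContDiff ℝ 1 fun x => fderiv ℝ u x (Pi.single i 1) := fun i =>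
    (hu.fderiv_right (m := 1) (by norm_num)).clm_apply contDiff_const
  have hduc : ∀ i, HasCompactSupport fun x => fderiv ℝ u x (Pi.single i 1) := fun i =>
    huc.fderiv_apply ℝ _
  have h_partial : ∀ i, ∫⁻ x, ‖fderiv ℝ u x (Pi.single i 1)‖ₑ ≤ ENNReal.ofReal (bvNorm H) := by
    intro i
    rw [← ofReal_integral_norm_eq_lintegral_enorm
      ((hdu i).continuous.integrable_of_hasCompactSupport (hduc i))]
    exact ENNReal.ofReal_le_ofReal (integral_abs_le_of_forall_test (hdu i) (hduc i)
      fun ψ hψ hψc hψ1 => integral_fderiv_convolution_mul_le_bvNorm hH hHc b hψ hψc hψ1 i)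
  rw [eLpNorm_one_eq_lintegral_enorm]
  calc ∫⁻ x, ‖fderiv ℝ u x‖ₑ ≤ ∫⁻ x, ∑ i, ‖fderiv ℝ u x (Pi.single i 1)‖ₑ := by
        refine lintegral_mono fun x => ?_
        simp only [← ofReal_norm]
        rw [← ENNReal.ofReal_sum_of_nonneg fun i _ => norm_nonneg _]
        exact ENNReal.ofReal_le_ofReal (norm_clm_pi_le_sum _)
    _ = ∑ i, ∫⁻ x, ‖fderiv ℝ u x (Pi.single i 1)‖ₑ :=
        lintegral_finsetSum _ fun i _ => (hdu i).continuous.measurable.enorm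
    _ ≤ ∑ _i : Fin d, ENNReal.ofReal (bvNorm H) := Finset.sum_le_sum fun i _ => h_partial i
    _ = d * ENNReal.ofReal (bvNorm H) := by simp

/-- The Gagliardo–Nirenberg–Sobolev inequality for compactly supported `BV` functions. -/
lemma eLpNorm_le_bvNorm {d : ℕ} {H : (Fin d → ℝ) → ℝ} (hH : MemBV H)
    (hHc : HasCompactSupport H) {p : ℝ≥0} (hp : (d : ℝ≥0).HolderConjugate p) :
    eLpNorm H p volume ≤
      eLpNormLESNormFDerivOneConst (volume : Measure (Fin d → ℝ)) p *
        (d * ENNReal.ofReal (bvNorm H)) := by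
  let b : ℕ → ContDiffBump (0 : Fin d → ℝ) := fun n =>
    { rIn := 1 / (n + 1)
      rOut := 2 * (1 / (n + 1))
      rIn_pos := by positivity
      rIn_lt_rOut := by
        have : (0 : ℝ) < 1 / (n + 1) := by positivity
        linarith }
  have h_rOut : Tendsto (fun n => (b n).rOut) atTop (𝓝 0) := by
    simpa [b] using (tendsto_one_div_add_atTop_nhds_zero_nat (𝕜 := ℝ)).const_mul 2
  set u : ℕ → (Fin d → ℝ) → ℝ := fun n =>
    (b n).normed volume ⋆[ContinuousLinearMap.lsmul ℝ ℝ, volume] H with hu_def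
  have h_lim : ∀ᵐ x, Tendsto (fun n => u n x) atTop (𝓝 (H x)) :=
    ContDiffBump.ae_convolution_tendsto_right_of_locallyIntegrable (K := 2) h_rOut
      (Eventually.of_forall fun n => le_rfl) hH.1.locallyIntegrable
  have hu : ∀ n, ContDiff ℝ 1 (u n) := fun n =>
    (b n).hasCompactSupport_normed.contDiff_convolution_left (n := 1) _
      ((b n).contDiff_normed (n := 1)) hH.1.locallyIntegrable
  have h_bound : ∀ n, eLpNorm (u n) p volume ≤
      eLpNormLESNormFDerivOneConst (volume : Measure (Fin d → ℝ)) p *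
        (d * ENNReal.ofReal (bvNorm H)) := by
    intro n
    refine (eLpNorm_le_eLpNorm_fderiv_one volume (hu n)
      (HasCompactSupport.convolution _ (b n).hasCompactSupport_normed hHc)
      (by simpa using hp)).trans ?_
    gcongr
    exact eLpNorm_fderiv_convolution_le hH hHc (b n)
  refine (Lp.eLpNorm_lim_le_liminf_eLpNorm
    (fun n => (hu n).continuous.aestronglyMeasurable) H h_lim).trans ?_
  exact liminf_le_of_le (by isBoundedDefault) fun a ha => by
    obtain ⟨n, hn⟩ := ha.exists
    exact hn.trans (h_bound n)

/-- The set `s` need not be null measurable, so `h` and `s.indicator h` may differ on a set which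
is not negligible for `μ.restrict s`. -/
lemma integral_indicator_of_ne_zero {α : Type*} [MeasurableSpace α] {μ : Measure α} {s : Set α}
    {h : α → ℝ} (hs : AEStronglyMeasurable (s.indicator h) μ) (h_ne : ∫ x in s, h x ∂μ ≠ 0) :
    ∫ x, s.indicator h x ∂μ = ∫ x in s, h x ∂μ := by
  have h_meas : AEStronglyMeasurable h (μ.restrict s) := by
    by_contra h_not
    exact h_ne (integral_undef fun h_int => h_not h_int.1)
  have h_ind : AEStronglyMeasurable (s.indicator h) (μ.restrict s) := hs.restrict
  rw [← setIntegral_eq_integral_of_forall_compl_eq_zero (s := s) fun x hx =>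
    indicator_of_notMem hx h]
  refine integral_congr_ae (h_ind.ae_eq_mk.trans (Filter.EventuallyEq.trans ?_
    h_meas.ae_eq_mk.symm))
  have h_set : MeasurableSet {x | h_ind.mk _ x = h_meas.mk _ x} :=
    measurableSet_eq_fun h_ind.stronglyMeasurable_mk.measurable
      h_meas.stronglyMeasurable_mk.measurable
  have h1 := ae_imp_of_ae_restrict h_ind.ae_eq_mk
  have h2 := ae_imp_of_ae_restrict h_meas.ae_eq_mk
  refine (ae_restrict_iff h_set).2 ?_
  filter_upwards [h1, h2] with x hx1 hx2 hx
  rw [← hx1 hx, ← hx2 hx, indicator_of_mem hx]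

/-- A probability density on the unit cube has mass at least `1/2` on `{1/2 ≤ H}`. -/
lemma half_le_lintegral_superlevel {d : ℕ} {H : (Fin d → ℝ) → ℝ} (hH : Integrable H)
    (hH0 : ∀ x, 0 ≤ H x) (hH_supp : ∀ x ∉ Icc (0 : Fin d → ℝ) 1, H x = 0)
    (hH1 : ∫ x, H x = 1) :
    (1 / 2 : ℝ≥0∞) ≤ ∫⁻ x in {x | 1 / 2 ≤ H x}, ‖H x‖ₑ := by
  have hA : NullMeasurableSet {x | 1 / 2 ≤ H x} :=
    nullMeasurableSet_le aemeasurable_const hH.aemeasurable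
  have h_total : ∫⁻ x, ‖H x‖ₑ = 1 := by
    rw [← ofReal_integral_norm_eq_lintegral_enorm hH]
    simp [Real.norm_of_nonneg (hH0 _), hH1]
  have h_cube : volume (Icc (0 : Fin d → ℝ) 1) = 1 := by
    simp [Real.volume_Icc_pi]
  have h_le : (1 : ℝ≥0∞) ≤ (∫⁻ x in {x | 1 / 2 ≤ H x}, ‖H x‖ₑ) + 1 / 2 := by
    calc (1 : ℝ≥0∞) = ∫⁻ x, ‖H x‖ₑ := h_total.symm
      _ ≤ ∫⁻ x, ({x | 1 / 2 ≤ H x}.indicator (fun x => ‖H x‖ₑ) x +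
            (Icc (0 : Fin d → ℝ) 1).indicator (fun _ => 1 / 2) x) := by
          refine lintegral_mono fun x => ?_
          by_cases hx : 1 / 2 ≤ H x
          · rw [indicator_of_mem (show x ∈ {x | 1 / 2 ≤ H x} from hx)]
            exact le_self_add
          · by_cases hxc : x ∈ Icc (0 : Fin d → ℝ) 1
            · rw [indicator_of_mem hxc]
              refine le_trans ?_ le_add_self
              rw [Real.enorm_of_nonneg (hH0 x)]
              refine ENNReal.ofReal_le_of_le_toReal ?_
              simpa using (not_le.1 hx).le
            · simp [hH_supp x hxc]
      _ = (∫⁻ x in {x | 1 / 2 ≤ H x}, ‖H x‖ₑ) + 1 / 2 := by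
          rw [lintegral_add_right _ (measurable_const.indicator measurableSet_Icc),
            lintegral_indicator₀ hA, lintegral_indicator_const measurableSet_Icc, h_cube, mul_one]
  have h_half : (1 / 2 : ℝ≥0∞) + 1 / 2 = 1 := by simp [ENNReal.inv_two_add_inv_two]
  exact (ENNReal.add_le_add_iff_right (a := 1 / 2) (by simp)).1 (h_half.trans_le h_le)

theorem statement15 {d : ℕ} (hd : 2 ≤ d) :
    ∃ C > (0:ℝ), ∀ Ω : Set (Fin d → ℝ), Ω ⊆ Set.Icc 0 1 →
      ∀ h : (Fin d → ℝ) → ℝ, MemBVOn Ω h → (∀ x, 0 ≤ h x) →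
        (∫ x in Ω, h x = 1) →
        ENNReal.ofReal ((2 * C * bvNormOn Ω h) ^ d)⁻¹ ≤
          volume {x ∈ Ω | 1 / 2 ≤ h x} := by
  have hd1 : (1 : ℝ≥0) < d := by exact_mod_cast hd
  have hd0 : (0 : ℝ) < d := by positivity
  set p : ℝ≥0 := NNReal.conjExponent d with hp_def
  have hp : (d : ℝ≥0).HolderConjugate p := NNReal.HolderConjugate.conjExponent hd1
  set S : ℝ≥0 := eLpNormLESNormFDerivOneConst (volume : Measure (Fin d → ℝ)) p with hS
  refine ⟨S * d + 1, by positivity, fun Ω hΩ h hBV h0 h1 => ?_⟩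
  set H := Ω.indicator h with hH_def
  have hH : MemBV H := hBV
  have hH0 : ∀ x, 0 ≤ H x := fun x => indicator_nonneg (fun x _ => h0 x) x
  have hH_supp : ∀ x ∉ Icc (0 : Fin d → ℝ) 1, H x = 0 := fun x hx =>
    indicator_of_notMem (fun hxΩ => hx (hΩ hxΩ)) h
  have hHc : HasCompactSupport H := HasCompactSupport.intro isCompact_Icc hH_supp
  have hH1 : ∫ x, H x = 1 := by
    rw [hH_def, integral_indicator_of_ne_zero hH.1.1 (by simp [h1]), h1]
  have hA : {x ∈ Ω | 1 / 2 ≤ h x} = {x | 1 / 2 ≤ H x} := by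
    ext x
    by_cases hx : x ∈ Ω
    · simp [hH_def, hx]
    · simp [hH_def, hx]
  rw [hA, show bvNormOn Ω h = bvNorm H from rfl]
  set V := bvNorm H with hV
  have hV0 : 0 ≤ V := ENNReal.toReal_nonneg
  set m := volume {x | 1 / 2 ≤ H x} with hm
  have h_exp : 1 / (1 : ℝ≥0∞).toReal - 1 / (p : ℝ≥0∞).toReal = (d : ℝ)⁻¹ := by
    have := hp.coe.inv_add_inv_eq_one
    simp only [ENNReal.toReal_one, ENNReal.coe_toReal, one_div, inv_one]
    push_cast at this
    linarith
  have h_holder : (1 / 2 : ℝ≥0∞) ≤ ENNReal.ofReal ((S * d + 1) * V) * m ^ (d : ℝ)⁻¹ := by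
    calc (1 / 2 : ℝ≥0∞) ≤ ∫⁻ x in {x | 1 / 2 ≤ H x}, ‖H x‖ₑ :=
          half_le_lintegral_superlevel hH.1 hH0 hH_supp hH1
      _ = eLpNorm H 1 (volume.restrict {x | 1 / 2 ≤ H x}) :=
          eLpNorm_one_eq_lintegral_enorm.symm
      _ ≤ eLpNorm H p (volume.restrict {x | 1 / 2 ≤ H x}) * m ^ (d : ℝ)⁻¹ := by
          have := eLpNorm_le_eLpNorm_mul_rpow_measure_univ (p := 1) (q := p)
            (μ := volume.restrict {x | 1 / 2 ≤ H x})
            (by exact_mod_cast hp.symm.lt.le) hH.1.1.restrict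
          rwa [h_exp, Measure.restrict_apply_univ] at this
      _ ≤ ENNReal.ofReal ((S * d + 1) * V) * m ^ (d : ℝ)⁻¹ := by
          gcongr
          calc eLpNorm H p (volume.restrict {x | 1 / 2 ≤ H x}) ≤ eLpNorm H p volume :=
                eLpNorm_restrict_le _ _ _ _
            _ ≤ S * (d * ENNReal.ofReal V) := eLpNorm_le_bvNorm hH hHc hp
            _ = ENNReal.ofReal (S * d * V) := by
                rw [ENNReal.ofReal_mul (by positivity), ENNReal.ofReal_mul (by positivity),
                  ENNReal.ofReal_coe_nnreal, ENNReal.ofReal_natCast, mul_assoc]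
            _ ≤ ENNReal.ofReal ((S * d + 1) * V) := by
                apply ENNReal.ofReal_le_ofReal
                nlinarith
  have hV_pos : 0 < V := by
    rcases hV0.eq_or_lt with hV_zero | hV_pos
    · simp [← hV_zero] at h_holder
    · exact hV_pos
  set c := (S * d + 1) * V with hc
  have hc_pos : 0 < c := by positivity
  have h_root : ENNReal.ofReal (2 * c)⁻¹ ≤ m ^ (d : ℝ)⁻¹ := by
    have h_ne : ENNReal.ofReal c ≠ 0 := by simpa using hc_pos
    rw [ENNReal.ofReal_inv_of_pos (by positivity), ENNReal.ofReal_mul zero_le_two,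
      ENNReal.mul_inv (by simp) (by simp)]
    rw [mul_comm, ← ENNReal.div_eq_inv_mul]
    refine ENNReal.div_le_of_le_mul' ?_
    simpa using h_holder
  calc ENNReal.ofReal ((2 * (S * d + 1) * V) ^ d)⁻¹ = ENNReal.ofReal (2 * c)⁻¹ ^ d := by
        rw [← ENNReal.ofReal_pow (by positivity), inv_pow, hc, mul_assoc]
    _ ≤ (m ^ (d : ℝ)⁻¹) ^ d := by gcongr
    _ = m := by
        rw [← ENNReal.rpow_natCast, ← ENNReal.rpow_mul, inv_mul_cancel₀ hd0.ne', ENNReal.rpow_one]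

end Liverani
end
end
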